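/- If H1 is a middle Σ-galaxy and H2 is a central triangular galaxy, then there exists ε > 0 such that every {H1,H2}-free tournament T contains a transitive subtournament of size at least |T|^ε. -/

import Mathlib

open Finset

/-- A tournament on vertex set `Fin n`: `adj u v` means there is an arc from `u` to `v`. -/
structure Tournament (n : ℕ) where
  adj : Fin n → Fin n → Prop
  asymm : ∀ u v, adj u v → ¬ adj v u
  total : ∀ u v, u ≠ v → adj u v ∨ adj v u

namespace Tournament

variable {n N : ℕ}

/-- The position of vertex `v` in the ordering `θ`, where `θ k` is the `k`-th vertex. -/
def pos (θ : Equiv.Perm (Fin n)) (v : Fin n) : Fin n := θ.symm v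

/-- The arc `u → v` of `T` is a backward arc under the ordering `θ`. -/
def Backward (T : Tournament n) (θ : Equiv.Perm (Fin n)) (u v : Fin n) : Prop :=
  T.adj u v ∧ pos θ v < pos θ u

/-- `x` lies strictly between two elements of `L` under the ordering `θ`. -/
def BetweenSet (θ : Equiv.Perm (Fin n)) (L : Finset (Fin n)) (x : Fin n) : Prop :=
  ∃ u ∈ L, ∃ w ∈ L, pos θ u < pos θ x ∧ pos θ x < pos θ w

/-- The induced subtournament of `T` on `s` is transitive. -/
def IsTransOn (T : Tournament n) (s : Finset (Fin n)) : Prop :=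
  ∀ u ∈ s, ∀ v ∈ s, ∀ w ∈ s, T.adj u v → T.adj v w → T.adj u w

/-- The largest size of a transitive subtournament of `T` contained in `s`. -/
noncomputable def trSizeOn (T : Tournament n) (s : Finset (Fin n)) : ℕ :=
  sSup {k | ∃ t, t ⊆ s ∧ T.IsTransOn t ∧ t.card = k}

/-- `tr(T)`: the largest size of a transitive subtournament of `T`. -/
noncomputable def trSize (T : Tournament n) : ℕ := T.trSizeOn Finset.univ

/-- `T` contains `H`: some induced subtournament of `T` is isomorphic to `H`. -/
def Contains (T : Tournament N) (H : Tournament n) : Prop :=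
  ∃ f : Fin n ↪ Fin N, ∀ u v, H.adj u v ↔ T.adj (f u) (f v)

/-- `T` is `ε`-critical. -/
def EpsCritical (T : Tournament n) (ε : ℝ) : Prop :=
  ((T.trSize : ℝ) < (n : ℝ) ^ ε) ∧
  ∀ s : Finset (Fin n), s ≠ Finset.univ → ((s.card : ℝ) ^ ε ≤ (T.trSizeOn s : ℝ))

/-- `S` with center `c` is a right star of `T` under `θ`. -/
def IsRightStarAt (T : Tournament n) (θ : Equiv.Perm (Fin n)) (S : Finset (Fin n))
    (c : Fin n) : Prop :=
  c ∈ S ∧ (S.erase c).Nonempty ∧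
  (∀ v ∈ S.erase c, pos θ v < pos θ c ∧ T.adj c v) ∧
  (∀ u ∈ S, ∀ v ∈ S, T.Backward θ u v → u = c)

/-- `S` with center `c` is a left star of `T` under `θ`. -/
def IsLeftStarAt (T : Tournament n) (θ : Equiv.Perm (Fin n)) (S : Finset (Fin n))
    (c : Fin n) : Prop :=
  c ∈ S ∧ (S.erase c).Nonempty ∧
  (∀ v ∈ S.erase c, pos θ c < pos θ v ∧ T.adj v c) ∧
  (∀ u ∈ S, ∀ v ∈ S, T.Backward θ u v → v = c)

/-- `S` with center `c` is a middle star of `T` under `θ`. -/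
def IsMiddleStarAt (T : Tournament n) (θ : Equiv.Perm (Fin n)) (S : Finset (Fin n))
    (c : Fin n) : Prop :=
  c ∈ S ∧
  (∃ v ∈ S.erase c, pos θ v < pos θ c) ∧ (∃ v ∈ S.erase c, pos θ c < pos θ v) ∧
  (∀ v ∈ S.erase c, (pos θ v < pos θ c → T.adj c v) ∧ (pos θ c < pos θ v → T.adj v c)) ∧
  (∀ u ∈ S, ∀ v ∈ S, T.Backward θ u v → u = c ∨ v = c)

def IsFrontierStarAt (T : Tournament n) (θ : Equiv.Perm (Fin n)) (S : Finset (Fin n))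
    (c : Fin n) : Prop :=
  T.IsLeftStarAt θ S c ∨ T.IsRightStarAt θ S c

def IsStarAt (T : Tournament n) (θ : Equiv.Perm (Fin n)) (S : Finset (Fin n))
    (c : Fin n) : Prop :=
  T.IsLeftStarAt θ S c ∨ T.IsRightStarAt θ S c ∨ T.IsMiddleStarAt θ S c

/-- A middle star with exactly one leaf after the center (center is `u_{p-1}`). -/
def IsOneRightMiddleStarAt (T : Tournament n) (θ : Equiv.Perm (Fin n)) (S : Finset (Fin n))
    (c : Fin n) : Prop :=
  T.IsMiddleStarAt θ S c ∧ ((S.erase c).filter (fun v => pos θ c < pos θ v)).card = 1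

/-- A middle star with exactly one leaf before the center (center is `u_2`). -/
def IsOneLeftMiddleStarAt (T : Tournament n) (θ : Equiv.Perm (Fin n)) (S : Finset (Fin n))
    (c : Fin n) : Prop :=
  T.IsMiddleStarAt θ S c ∧ ((S.erase c).filter (fun v => pos θ v < pos θ c)).card = 1

/-- Kinds of super 2-nebulas. -/
inductive NebKind
  | left
  | middle
  | right

/-- Common requirements on the data of a super 2-nebula: vertex set `S`, centers `c₁, c₂`
(`c₁` before `c₂` under `θ`), leaves `L₁` incident to `c₁` and `L₂` incident to `c₂`. -/
def Super2NebCommon (θ : Equiv.Perm (Fin n)) (S : Finset (Fin n)) (c₁ c₂ : Fin n)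
    (L₁ L₂ : Finset (Fin n)) : Prop :=
  L₁.Nonempty ∧ L₂.Nonempty ∧ Disjoint L₁ L₂ ∧
  c₁ ∉ L₁ ∪ L₂ ∧ c₂ ∉ L₁ ∪ L₂ ∧ c₁ ≠ c₂ ∧
  S = insert c₁ (insert c₂ (L₁ ∪ L₂)) ∧ pos θ c₁ < pos θ c₂

/-- `S` is a super (left/middle/right) 2-nebula of `T` under `θ`, with centers `c₁, c₂` and
leaves `L₁` (incident to `c₁`) and `L₂` (incident to `c₂`). -/
def IsSuper2NebulaAt (T : Tournament n) (θ : Equiv.Perm (Fin n)) (S : Finset (Fin n))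
    (c₁ c₂ : Fin n) (L₁ L₂ : Finset (Fin n)) : NebKind → Prop
  | NebKind.middle =>
      Super2NebCommon θ S c₁ c₂ L₁ L₂ ∧
      (∀ v ∈ L₁ ∪ L₂, pos θ c₁ < pos θ v ∧ pos θ v < pos θ c₂) ∧
      (∀ v ∈ L₁, T.adj v c₁) ∧ (∀ v ∈ L₂, T.adj c₂ v) ∧ T.adj c₂ c₁ ∧
      (∀ u ∈ S, ∀ v ∈ S, T.Backward θ u v →
        (u ∈ L₁ ∧ v = c₁) ∨ (u = c₂ ∧ v ∈ L₂) ∨ (u = c₂ ∧ v = c₁))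
  | NebKind.left =>
      Super2NebCommon θ S c₁ c₂ L₁ L₂ ∧
      (∀ v ∈ L₁ ∪ L₂, pos θ v < pos θ c₁) ∧
      (∀ v ∈ L₁, T.adj c₁ v) ∧ (∀ v ∈ L₂, T.adj c₂ v) ∧ T.adj c₂ c₁ ∧
      (∀ u ∈ S, ∀ v ∈ S, T.Backward θ u v →
        (u = c₁ ∧ v ∈ L₁) ∨ (u = c₂ ∧ v ∈ L₂) ∨ (u = c₂ ∧ v = c₁))
  | NebKind.right =>
      Super2NebCommon θ S c₁ c₂ L₁ L₂ ∧
      (∀ v ∈ L₁ ∪ L₂, pos θ c₂ < pos θ v) ∧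
      (∀ v ∈ L₁, T.adj v c₁) ∧ (∀ v ∈ L₂, T.adj v c₂) ∧ T.adj c₂ c₁ ∧
      (∀ u ∈ S, ∀ v ∈ S, T.Backward θ u v →
        (u ∈ L₁ ∧ v = c₁) ∨ (u ∈ L₂ ∧ v = c₂) ∨ (u = c₂ ∧ v = c₁))

/-- A decomposition of `T` witnessing that `T` is a super nebula under `θ`, with stars
`Q i` (centers `ctr i`) and super 2-nebulas `Sig i` (centers `c₁ i, c₂ i`, leaves
`L₁ i, L₂ i`, of kind `kd i`). -/
def SuperNebulaDecomp (T : Tournament n) (θ : Equiv.Perm (Fin n)) {m l : ℕ}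
    (Q : Fin m → Finset (Fin n)) (ctr : Fin m → Fin n)
    (Sig : Fin l → Finset (Fin n)) (c₁ c₂ : Fin l → Fin n)
    (L₁ L₂ : Fin l → Finset (Fin n)) (kd : Fin l → NebKind) : Prop :=
  (∀ i, T.IsStarAt θ (Q i) (ctr i)) ∧
  (∀ i, T.IsSuper2NebulaAt θ (Sig i) (c₁ i) (c₂ i) (L₁ i) (L₂ i) (kd i)) ∧
  (∀ i j, i ≠ j → Disjoint (Q i) (Q j)) ∧
  (∀ i j, i ≠ j → Disjoint (Sig i) (Sig j)) ∧
  (∀ i j, Disjoint (Q i) (Sig j)) ∧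
  (∀ u v, T.Backward θ u v → (∃ i, u ∈ Q i ∧ v ∈ Q i) ∨ (∃ i, u ∈ Sig i ∧ v ∈ Sig i)) ∧
  (∀ i j, ¬ BetweenSet θ (L₁ j ∪ L₂ j) (ctr i)) ∧
  (∀ i j, i ≠ j → ¬ BetweenSet θ (L₁ j ∪ L₂ j) (c₁ i) ∧ ¬ BetweenSet θ (L₁ j ∪ L₂ j) (c₂ i))

/-- `T` is a super nebula. -/
def IsSuperNebula (T : Tournament n) : Prop :=
  ∃ (θ : Equiv.Perm (Fin n)) (m l : ℕ) (Q : Fin m → Finset (Fin n)) (ctr : Fin m → Fin n)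
    (Sig : Fin l → Finset (Fin n)) (c₁ c₂ : Fin l → Fin n)
    (L₁ L₂ : Fin l → Finset (Fin n)) (kd : Fin l → NebKind),
    SuperNebulaDecomp T θ Q ctr Sig c₁ c₂ L₁ L₂ kd

/-- `{a, b, c}` (in this position order) is a triangle of `T` under `θ`:
`a` is the left exterior, `b` the center, `c` the right exterior. -/
def IsTriangleAt (T : Tournament n) (θ : Equiv.Perm (Fin n)) (a b c : Fin n) : Prop :=
  pos θ a < pos θ b ∧ pos θ b < pos θ c ∧ T.adj b a ∧ T.adj c a ∧ T.adj c b

/-- A decomposition of `T` under `θ` into triangles `{A i, B i, C i}` (left exterior, center,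
right exterior) and frontier stars `Q j` with centers `ctr j`, where for each triangle `i`,
the vertices in `forb i` are not allowed to lie between leaves of a star. -/
def TriGalaxyDecomp (T : Tournament n) (θ : Equiv.Perm (Fin n)) {l k : ℕ}
    (A B C : Fin l → Fin n) (Q : Fin k → Finset (Fin n)) (ctr : Fin k → Fin n)
    (forb : Fin l → Finset (Fin n)) : Prop :=
  (∀ i, T.IsTriangleAt θ (A i) (B i) (C i)) ∧
  (∀ j, T.IsFrontierStarAt θ (Q j) (ctr j)) ∧
  (∀ i j, i ≠ j →
    Disjoint ({A i, B i, C i} : Finset (Fin n)) ({A j, B j, C j} : Finset (Fin n))) ∧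
  (∀ i j, Disjoint ({A i, B i, C i} : Finset (Fin n)) (Q j)) ∧
  (∀ i j, i ≠ j → Disjoint (Q i) (Q j)) ∧
  (∀ u v, T.Backward θ u v →
    (∃ i, u ∈ ({A i, B i, C i} : Finset (Fin n)) ∧ v ∈ ({A i, B i, C i} : Finset (Fin n))) ∨
    (∃ j, u ∈ Q j ∧ v ∈ Q j)) ∧
  (∀ i j, i ≠ j → ¬ BetweenSet θ ((Q j).erase (ctr j)) (ctr i)) ∧
  (∀ i j, ∀ x ∈ forb i, ¬ BetweenSet θ ((Q j).erase (ctr j)) x)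

/-- `T` is a Δgalaxy: a triangular galaxy with exactly one triangle. -/
def IsDeltaGalaxy (T : Tournament n) : Prop :=
  ∃ (θ : Equiv.Perm (Fin n)) (a b c : Fin n) (k : ℕ)
    (Q : Fin k → Finset (Fin n)) (ctr : Fin k → Fin n),
    TriGalaxyDecomp T θ (fun _ : Fin 1 => a) (fun _ => b) (fun _ => c) Q ctr
      (fun _ => ({a, b, c} : Finset (Fin n)))

/-- `T` is a central triangular galaxy: centers of triangles may lie between leaves of stars. -/
def IsCentralTriangularGalaxy (T : Tournament n) : Prop :=
  ∃ (θ : Equiv.Perm (Fin n)) (l k : ℕ) (A B C : Fin l → Fin n)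
    (Q : Fin k → Finset (Fin n)) (ctr : Fin k → Fin n),
    TriGalaxyDecomp T θ A B C Q ctr (fun i => ({A i, C i} : Finset (Fin n)))

/-- `T` is a left triangular galaxy: left exteriors of triangles may lie between leaves. -/
def IsLeftTriangularGalaxy (T : Tournament n) : Prop :=
  ∃ (θ : Equiv.Perm (Fin n)) (l k : ℕ) (A B C : Fin l → Fin n)
    (Q : Fin k → Finset (Fin n)) (ctr : Fin k → Fin n),
    TriGalaxyDecomp T θ A B C Q ctr (fun i => ({B i, C i} : Finset (Fin n)))

/-- `T` is a right triangular galaxy: right exteriors of triangles may lie between leaves. -/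
def IsRightTriangularGalaxy (T : Tournament n) : Prop :=
  ∃ (θ : Equiv.Perm (Fin n)) (l k : ℕ) (A B C : Fin l → Fin n)
    (Q : Fin k → Finset (Fin n)) (ctr : Fin k → Fin n),
    TriGalaxyDecomp T θ A B C Q ctr (fun i => ({A i, B i} : Finset (Fin n)))

/-- A decomposition of `T` witnessing that `T` is a nebula under `θ` (no condition on the
location of the centers of the stars). -/
def NebulaDecomp (T : Tournament n) (θ : Equiv.Perm (Fin n)) {k : ℕ}
    (Q : Fin k → Finset (Fin n)) (ctr : Fin k → Fin n) : Prop :=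
  (∀ i, T.IsStarAt θ (Q i) (ctr i)) ∧
  (∀ i j, i ≠ j → Disjoint (Q i) (Q j)) ∧
  (∀ u v, T.Backward θ u v → ∃ i, u ∈ Q i ∧ v ∈ Q i)

/-- `T` is a central nebula: a nebula all of whose stars are 3-vertex middle stars. -/
def IsCentralNebula (T : Tournament n) : Prop :=
  ∃ (θ : Equiv.Perm (Fin n)) (k : ℕ) (Q : Fin k → Finset (Fin n)) (ctr : Fin k → Fin n),
    NebulaDecomp T θ Q ctr ∧ ∀ i, T.IsMiddleStarAt θ (Q i) (ctr i) ∧ (Q i).card = 3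

/-- `T` is a super left nebula: a nebula all of whose stars are left stars. -/
def IsSuperLeftNebula (T : Tournament n) : Prop :=
  ∃ (θ : Equiv.Perm (Fin n)) (k : ℕ) (Q : Fin k → Finset (Fin n)) (ctr : Fin k → Fin n),
    NebulaDecomp T θ Q ctr ∧ ∀ i, T.IsLeftStarAt θ (Q i) (ctr i)

/-- `T` is a super right nebula: a nebula all of whose stars are right stars. -/
def IsSuperRightNebula (T : Tournament n) : Prop :=
  ∃ (θ : Equiv.Perm (Fin n)) (k : ℕ) (Q : Fin k → Finset (Fin n)) (ctr : Fin k → Fin n),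
    NebulaDecomp T θ Q ctr ∧ ∀ i, T.IsRightStarAt θ (Q i) (ctr i)

/-- `T` is an LR-Δgalaxy: a super Δgalaxy in which only the two exteriors of the triangle
may lie between leaves of a star. -/
def IsLRDeltaGalaxy (T : Tournament n) : Prop :=
  ∃ (θ : Equiv.Perm (Fin n)) (a b c : Fin n) (k : ℕ)
    (Q : Fin k → Finset (Fin n)) (ctr : Fin k → Fin n),
    TriGalaxyDecomp T θ (fun _ : Fin 1 => a) (fun _ => b) (fun _ => c) Q ctr
      (fun _ => ({b} : Finset (Fin n)))

/-- `T` is a CR-Δgalaxy. -/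
def IsCRDeltaGalaxy (T : Tournament n) : Prop :=
  ∃ (θ : Equiv.Perm (Fin n)) (a b c : Fin n) (k : ℕ)
    (Q : Fin k → Finset (Fin n)) (ctr : Fin k → Fin n),
    TriGalaxyDecomp T θ (fun _ : Fin 1 => a) (fun _ => b) (fun _ => c) Q ctr
      (fun _ => ({a} : Finset (Fin n))) ∧
    (∀ i j, i ≠ j → BetweenSet θ ((Q i).erase (ctr i)) b →
      BetweenSet θ ((Q j).erase (ctr j)) c →
      (∀ x ∈ (Q i).erase (ctr i), ¬ BetweenSet θ ((Q j).erase (ctr j)) x) ∧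
      (∀ x ∈ (Q j).erase (ctr j), ¬ BetweenSet θ ((Q i).erase (ctr i)) x)) ∧
    (∀ i, BetweenSet θ ((Q i).erase (ctr i)) b → ¬ BetweenSet θ ((Q i).erase (ctr i)) c)

/-- `T` is a CL-Δgalaxy. -/
def IsCLDeltaGalaxy (T : Tournament n) : Prop :=
  ∃ (θ : Equiv.Perm (Fin n)) (a b c : Fin n) (k : ℕ)
    (Q : Fin k → Finset (Fin n)) (ctr : Fin k → Fin n),
    TriGalaxyDecomp T θ (fun _ : Fin 1 => a) (fun _ => b) (fun _ => c) Q ctr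
      (fun _ => ({c} : Finset (Fin n))) ∧
    (∀ i j, i ≠ j → BetweenSet θ ((Q i).erase (ctr i)) b →
      BetweenSet θ ((Q j).erase (ctr j)) a →
      (∀ x ∈ (Q i).erase (ctr i), ¬ BetweenSet θ ((Q j).erase (ctr j)) x) ∧
      (∀ x ∈ (Q j).erase (ctr j), ¬ BetweenSet θ ((Q i).erase (ctr i)) x)) ∧
    (∀ i, BetweenSet θ ((Q i).erase (ctr i)) b → ¬ BetweenSet θ ((Q i).erase (ctr i)) a)

/-- A decomposition of `T` under `θ` into one super 2-nebula (of kind `kd`) and frontier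
stars, covering all of `V(T)`, witnessing that `T` is a Σ-galaxy under `θ`. -/
def SigmaGalaxyDecomp (T : Tournament n) (θ : Equiv.Perm (Fin n))
    (S : Finset (Fin n)) (c₁ c₂ : Fin n) (L₁ L₂ : Finset (Fin n)) (kd : NebKind)
    {m : ℕ} (Q : Fin m → Finset (Fin n)) (ctr : Fin m → Fin n) : Prop :=
  T.IsSuper2NebulaAt θ S c₁ c₂ L₁ L₂ kd ∧
  (∀ j, T.IsFrontierStarAt θ (Q j) (ctr j)) ∧
  (∀ i j, i ≠ j → Disjoint (Q i) (Q j)) ∧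
  (∀ j, Disjoint S (Q j)) ∧
  (∀ v, v ∈ S ∨ ∃ j, v ∈ Q j) ∧
  (∀ u v, T.Backward θ u v → (u ∈ S ∧ v ∈ S) ∨ ∃ j, u ∈ Q j ∧ v ∈ Q j) ∧
  (∀ j, ¬ BetweenSet θ (L₁ ∪ L₂) (ctr j)) ∧
  (∀ j, ¬ BetweenSet θ ((Q j).erase (ctr j)) c₁ ∧ ¬ BetweenSet θ ((Q j).erase (ctr j)) c₂) ∧
  (∀ i j, i ≠ j → ¬ BetweenSet θ ((Q j).erase (ctr j)) (ctr i))

def IsMiddleSigmaGalaxy (T : Tournament n) : Prop :=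
  ∃ (θ : Equiv.Perm (Fin n)) (S : Finset (Fin n)) (c₁ c₂ : Fin n) (L₁ L₂ : Finset (Fin n))
    (m : ℕ) (Q : Fin m → Finset (Fin n)) (ctr : Fin m → Fin n),
    SigmaGalaxyDecomp T θ S c₁ c₂ L₁ L₂ NebKind.middle Q ctr

def IsLeftSigmaGalaxy (T : Tournament n) : Prop :=
  ∃ (θ : Equiv.Perm (Fin n)) (S : Finset (Fin n)) (c₁ c₂ : Fin n) (L₁ L₂ : Finset (Fin n))
    (m : ℕ) (Q : Fin m → Finset (Fin n)) (ctr : Fin m → Fin n),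
    SigmaGalaxyDecomp T θ S c₁ c₂ L₁ L₂ NebKind.left Q ctr

def IsRightSigmaGalaxy (T : Tournament n) : Prop :=
  ∃ (θ : Equiv.Perm (Fin n)) (S : Finset (Fin n)) (c₁ c₂ : Fin n) (L₁ L₂ : Finset (Fin n))
    (m : ℕ) (Q : Fin m → Finset (Fin n)) (ctr : Fin m → Fin n),
    SigmaGalaxyDecomp T θ S c₁ c₂ L₁ L₂ NebKind.right Q ctr

/-- The directed density from `X` to `Y`. -/
noncomputable def density (T : Tournament n) (X Y : Finset (Fin n)) : ℝ :=
  (Set.ncard {p : Fin n × Fin n | p.1 ∈ X ∧ p.2 ∈ Y ∧ T.adj p.1 p.2} : ℝ) /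
    ((X.card : ℝ) * (Y.card : ℝ))

/-- `(S i)` is a smooth `(c, lam, w)`-structure of `T`. -/
def IsSmoothStructure (T : Tournament n) (c lam : ℝ) {N : ℕ} (w : Fin N → Bool)
    (S : Fin N → Finset (Fin n)) : Prop :=
  (∀ i j, i ≠ j → Disjoint (S i) (S j)) ∧
  (∀ i, w i = false → c * (n : ℝ) ≤ ((S i).card : ℝ)) ∧
  (∀ i, w i = true → T.IsTransOn (S i) ∧ c * (T.trSize : ℝ) ≤ ((S i).card : ℝ)) ∧
  (∀ i j, i < j →
    (∀ v ∈ S i, 1 - lam ≤ T.density {v} (S j)) ∧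
    (∀ v ∈ S j, 1 - lam ≤ T.density (S i) {v}))

end Tournament

/-- The backward arcs of `K₆` under its canonical ordering. -/
def K6back : List (ℕ × ℕ) := [(3, 0), (5, 2), (5, 0), (4, 1)]

/-- The tournament `K₆`, on `Fin 6` with its canonical ordering. -/
def K6 : Tournament 6 where
  adj u v := (u.val, v.val) ∈ K6back ∨ (u < v ∧ (v.val, u.val) ∉ K6back)
  asymm := by decide
  total := by decide

/-- The pair `{H₁, H₂}` satisfies the Erdős–Hajnal conjecture: there is `ε > 0` such that
every `{H₁, H₂}`-free tournament `T` has a transitive subtournament of size `≥ |T| ^ ε`. -/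
def EHPair {n₁ n₂ : ℕ} (H₁ : Tournament n₁) (H₂ : Tournament n₂) : Prop :=
  ∃ ε : ℝ, 0 < ε ∧ ∀ (n : ℕ) (T : Tournament n),
    ¬ T.Contains H₁ → ¬ T.Contains H₂ → (n : ℝ) ^ ε ≤ (T.trSize : ℝ)

open Tournament

namespace Tournament

section Transitive

variable {n : ℕ} {T : Tournament n}

theorem adj_irrefl (T : Tournament n) (u : Fin n) : ¬ T.adj u u := fun h => T.asymm u u h h

theorem adj_of_not_adj {u v : Fin n} (h : u ≠ v) (hn : ¬ T.adj u v) : T.adj v u :=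
  (T.total u v h).resolve_left hn

theorem IsTransOn.subset {s t : Finset (Fin n)} (h : T.IsTransOn t) (hs : s ⊆ t) :
    T.IsTransOn s :=
  fun u hu v hv w hw => h u (hs hu) v (hs hv) w (hs hw)

theorem isTransOn_singleton (T : Tournament n) (v : Fin n) : T.IsTransOn {v} := by
  intro a ha b hb c hc hab
  rw [mem_singleton] at ha hb
  subst ha hb
  exact absurd hab (T.adj_irrefl _)

theorem bddAbove_trans_card (T : Tournament n) (s : Finset (Fin n)) :
    BddAbove {k | ∃ t, t ⊆ s ∧ T.IsTransOn t ∧ t.card = k} :=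
  ⟨s.card, by rintro k ⟨t, hts, -, rfl⟩; exact card_le_card hts⟩

theorem IsTransOn.card_le {s t : Finset (Fin n)} (ht : T.IsTransOn t) (hts : t ⊆ s) :
    t.card ≤ T.trSizeOn s :=
  le_csSup (T.bddAbove_trans_card s) ⟨t, hts, ht, rfl⟩

theorem exists_isTransOn_card_eq (T : Tournament n) (s : Finset (Fin n)) :
    ∃ t ⊆ s, T.IsTransOn t ∧ t.card = T.trSizeOn s :=
  Nat.sSup_mem (s := {k | ∃ t, t ⊆ s ∧ T.IsTransOn t ∧ t.card = k})
    ⟨0, ∅, by simp, by simp [IsTransOn], rfl⟩ (T.bddAbove_trans_card s)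

theorem IsTransOn.union {X Y : Finset (Fin n)} (hX : T.IsTransOn X) (hY : T.IsTransOn Y)
    (h : ∀ x ∈ X, ∀ y ∈ Y, T.adj x y) : T.IsTransOn (X ∪ Y) := by
  intro u hu v hv w hw huv hvw
  have back : ∀ x ∈ X, ∀ y ∈ Y, ¬ T.adj y x := fun x hx y hy => T.asymm x y (h x hx y hy)
  rw [mem_union] at hu hv hw
  rcases hu with hu | hu <;> rcases hv with hv | hv <;> rcases hw with hw | hw
  · exact hX u hu v hv w hw huv hvw
  · exact h u hu w hw
  · exact absurd hvw (back w hw v hv)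
  · exact h u hu w hw
  · exact absurd huv (back v hv u hu)
  · exact absurd huv (back v hv u hu)
  · exact absurd hvw (back w hw v hv)
  · exact hY u hu v hv w hw huv hvw

theorem trSizeOn_add_le {s X Y : Finset (Fin n)} (hX : X ⊆ s) (hY : Y ⊆ s)
    (h : ∀ x ∈ X, ∀ y ∈ Y, T.adj x y) : T.trSizeOn X + T.trSizeOn Y ≤ T.trSizeOn s := by
  obtain ⟨A, hA, hAt, hAc⟩ := T.exists_isTransOn_card_eq X
  obtain ⟨B, hB, hBt, hBc⟩ := T.exists_isTransOn_card_eq Y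
  have hAB : ∀ x ∈ A, ∀ y ∈ B, T.adj x y := fun x hx y hy => h x (hA hx) y (hB hy)
  have hd : Disjoint A B := disjoint_left.2 fun x hx hx' => T.adj_irrefl x (hAB x hx x hx')
  rw [← hAc, ← hBc, ← card_union_of_disjoint hd]
  exact (hAt.union hBt hAB).card_le (union_subset (hA.trans hX) (hB.trans hY))

theorem le_trSizeOn_of_two_pow_le (T : Tournament n) (k : ℕ) (s : Finset (Fin n))
    (h : 2 ^ k ≤ s.card) : k + 1 ≤ T.trSizeOn s := by
  classical
  induction k generalizing s with
  | zero =>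
    obtain ⟨v, hv⟩ : s.Nonempty := card_pos.1 (by simpa using h)
    simpa using (T.isTransOn_singleton v).card_le (singleton_subset_iff.2 hv)
  | succ k ih =>
    obtain ⟨v, hv⟩ : s.Nonempty := card_pos.1 (lt_of_lt_of_le (by positivity) h)
    have hsing : 1 ≤ T.trSizeOn {v} := by
      simpa using (T.isTransOn_singleton v).card_le subset_rfl
    have hsplit := card_filter_add_card_filter_not (s := s.erase v) (fun u => T.adj v u)
    rw [card_erase_of_mem hv] at hsplit
    have hcase : 2 ^ k ≤ #{u ∈ s.erase v | T.adj v u} ∨ 2 ^ k ≤ #{u ∈ s.erase v | ¬ T.adj v u} := by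
      rw [pow_succ] at h
      omega
    rcases hcase with hc | hc
    · have := ih _ hc
      have h2 := T.trSizeOn_add_le (s := s) (X := {v}) (Y := {u ∈ s.erase v | T.adj v u})
        (singleton_subset_iff.2 hv) ((filter_subset _ _).trans (erase_subset _ _))
        (by intro x hx y hy; rw [mem_singleton.1 hx]; exact (mem_filter.1 hy).2)
      omega
    · have := ih _ hc
      have h2 := T.trSizeOn_add_le (s := s) (Y := {v}) (X := {u ∈ s.erase v | ¬ T.adj v u})
        ((filter_subset _ _).trans (erase_subset _ _)) (singleton_subset_iff.2 hv)
        (by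
          intro x hx y hy
          rw [mem_singleton.1 hy]
          have hx := mem_filter.1 hx
          exact adj_of_not_adj (ne_of_mem_erase hx.1).symm hx.2)
      omega

theorem IsTransOn.exists_source {L : Finset (Fin n)} (hL : T.IsTransOn L) (hne : L.Nonempty) :
    ∃ v ∈ L, ∀ u ∈ L, u ≠ v → T.adj v u := by
  induction hne using Finset.Nonempty.cons_induction with
  | singleton a => exact ⟨a, by simp, by simp⟩
  | cons a s ha hs ih =>
    obtain ⟨v, hv, hvs⟩ := ih (hL.subset (subset_cons ha))
    have hav : a ≠ v := fun h => ha (h ▸ hv)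
    by_cases h : T.adj a v
    · refine ⟨a, by simp, fun u hu hua => ?_⟩
      have hus : u ∈ s := (mem_cons.1 hu).resolve_left hua
      by_cases huv : u = v
      · exact huv ▸ h
      · exact hL a (by simp) v (by simp [hv]) u hu h (hvs u hus huv)
    · refine ⟨v, by simp [hv], fun u hu huv => ?_⟩
      rcases mem_cons.1 hu with rfl | hus
      · exact adj_of_not_adj hav h
      · exact hvs u hus huv

theorem IsTransOn.exists_initial {L : Finset (Fin n)} (hL : T.IsTransOn L) (k : ℕ)
    (hk : k ≤ L.card) : ∃ I ⊆ L, I.card = k ∧ ∀ x ∈ I, ∀ y ∈ L \ I, T.adj x y := by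
  classical
  induction k with
  | zero => exact ⟨∅, by simp, by simp, by simp⟩
  | succ k ih =>
    obtain ⟨I, hIL, hIc, hI⟩ := ih (by omega)
    have hne : (L \ I).Nonempty := by
      rw [← card_pos, card_sdiff_of_subset hIL]
      omega
    obtain ⟨v, hv, hvs⟩ := (hL.subset sdiff_subset).exists_source hne
    rw [mem_sdiff] at hv
    refine ⟨insert v I, insert_subset hv.1 hIL, by rw [card_insert_of_notMem hv.2, hIc], ?_⟩
    intro x hx y hy
    simp only [mem_sdiff, mem_insert, not_or] at hy hx
    rcases hx with rfl | hx
    · exact hvs y (mem_sdiff.2 ⟨hy.1, hy.2.2⟩) hy.2.1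
    · exact hI x hx y (mem_sdiff.2 ⟨hy.1, hy.2.2⟩)

end Transitive

/-- Iterated removal of initial pieces of prescribed size. -/
theorem exists_blocks {α : Type*} [DecidableEq α] (Q : Finset α → Prop) (R : α → α → Prop)
    (k : ℕ)
    (step : ∀ L, Q L → k ≤ L.card →
      ∃ I ⊆ L, I.card = k ∧ Q (L \ I) ∧ ∀ x ∈ I, ∀ y ∈ L \ I, R x y)
    (m : ℕ) (L : Finset α) (hL : Q L) (hm : m * k ≤ L.card) :
    ∃ I : ℕ → Finset α, (∀ i < m, I i ⊆ L ∧ (I i).card = k) ∧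
      ∀ i j, i < j → j < m → ∀ x ∈ I i, ∀ y ∈ I j, R x y := by
  induction m generalizing L with
  | zero => exact ⟨fun _ => ∅, by simp, by simp⟩
  | succ m ih =>
    rw [Nat.succ_mul] at hm
    obtain ⟨J, hJL, hJc, hJQ, hJ⟩ := step L hL (by omega)
    obtain ⟨I, hI, hIR⟩ := ih (L \ J) hJQ (by rw [card_sdiff_of_subset hJL]; omega)
    refine ⟨fun i => if i = 0 then J else I (i - 1), ?_, ?_⟩
    · intro i hi
      rcases Nat.eq_zero_or_pos i with rfl | hpos
      · simp [hJL, hJc]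
      · simp only [hpos.ne', if_false]
        have := hI (i - 1) (by omega)
        exact ⟨this.1.trans sdiff_subset, this.2⟩
    · intro i j hij hj x hx y hy
      have hj0 : j ≠ 0 := by omega
      simp only [hj0, if_false] at hy
      rcases Nat.eq_zero_or_pos i with rfl | hpos
      · exact hJ x (by simpa using hx) y ((hI (j - 1) (by omega)).1 hy)
      · simp only [hpos.ne', if_false] at hx
        exact hIR (i - 1) (j - 1) (by omega) (by omega) x hx y hy

theorem IsTransOn.exists_intervals {n : ℕ} {T : Tournament n} {L : Finset (Fin n)}
    (hL : T.IsTransOn L) (m : ℕ) (hm : m ≤ L.card) :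
    ∃ I : ℕ → Finset (Fin n), (∀ i < m, I i ⊆ L ∧ L.card ≤ 2 * m * (I i).card) ∧
      ∀ i j, i < j → j < m → ∀ x ∈ I i, ∀ y ∈ I j, T.adj x y := by
  rcases Nat.eq_zero_or_pos m with rfl | hpos
  · exact ⟨fun _ => ∅, by simp, by simp⟩
  obtain ⟨I, hI, hIR⟩ := exists_blocks (fun L => T.IsTransOn L) T.adj (L.card / m)
    (fun L hL hk => by
      obtain ⟨I, h1, h2, h3⟩ := hL.exists_initial _ hk
      exact ⟨I, h1, h2, hL.subset sdiff_subset, h3⟩) m L hL (Nat.mul_div_le _ _)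
  refine ⟨I, fun i hi => ⟨(hI i hi).1, ?_⟩, hIR⟩
  rw [(hI i hi).2]
  have h1 : 1 ≤ L.card / m := (Nat.one_le_div_iff hpos).2 hm
  have h2 := Nat.lt_mul_div_succ L.card hpos
  nlinarith

theorem exists_disjoint_subsets {α : Type*} (s : Finset α) (m k : ℕ)
    (h : m * k ≤ s.card) :
    ∃ I : ℕ → Finset α, (∀ i < m, I i ⊆ s ∧ (I i).card = k) ∧
      ∀ i j, i < j → j < m → ∀ x ∈ I i, ∀ y ∈ I j, x ≠ y := by
  classical
  refine exists_blocks (fun _ => True) (· ≠ ·) k (fun L _ hk => ?_) m s trivial h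
  obtain ⟨I, hIL, hIc⟩ := exists_subset_card_eq hk
  refine ⟨I, hIL, hIc, trivial, fun x hx y hy hxy => ?_⟩
  exact (mem_sdiff.1 hy).2 (hxy ▸ hx)

section Density

open scoped Classical

variable {n : ℕ} {T : Tournament n}

/-- The number of pairs of `X × Y` that are not arcs from `X` to `Y`. -/
noncomputable def nonArcs (T : Tournament n) (X Y : Finset (Fin n)) : ℕ :=
  ∑ u ∈ X, #{v ∈ Y | ¬ T.adj u v}

theorem nonArcs_mono {X Y Y' : Finset (Fin n)} (hY : Y' ⊆ Y) :
    T.nonArcs X Y' ≤ T.nonArcs X Y :=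
  sum_le_sum fun _ _ => card_le_card (filter_subset_filter _ hY)

theorem nonArcs_comm (X Y : Finset (Fin n)) :
    T.nonArcs X Y = ∑ v ∈ Y, #{u ∈ X | ¬ T.adj u v} := by
  simp only [nonArcs, card_filter]
  exact sum_comm

theorem card_filter_mul_le_sum {α : Type*} (X : Finset α) (f : α → ℕ) (q q' y : ℕ)
    (h : q * ∑ u ∈ X, f u ≤ X.card * y) (hy : 0 < y) :
    q * #{u ∈ X | y < q' * f u} ≤ q' * X.card := by
  have h1 : #{u ∈ X | y < q' * f u} * y ≤ q' * ∑ u ∈ X, f u := by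
    rw [mul_sum, ← smul_eq_mul]
    calc _ ≤ ∑ u ∈ X with y < q' * f u, q' * f u :=
          card_nsmul_le_sum _ _ _ fun u hu => (mem_filter.1 hu).2.le
      _ ≤ _ := sum_le_sum_of_subset (filter_subset _ _)
  refine Nat.le_of_mul_le_mul_right ?_ hy
  calc q * #{u ∈ X | y < q' * f u} * y = q * (#{u ∈ X | y < q' * f u} * y) := by ring
    _ ≤ q * (q' * ∑ u ∈ X, f u) := Nat.mul_le_mul_left _ h1
    _ = q' * (q * ∑ u ∈ X, f u) := by ring
    _ ≤ q' * (X.card * y) := Nat.mul_le_mul_left _ h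
    _ = q' * X.card * y := by ring

theorem card_left_bad_le {X Y : Finset (Fin n)} {q : ℕ} (q' : ℕ)
    (h : q * T.nonArcs X Y ≤ X.card * Y.card) :
    q * #{u ∈ X | #Y < q' * #{v ∈ Y | ¬ T.adj u v}} ≤ q' * X.card := by
  rcases Nat.eq_zero_or_pos (#Y) with h0 | h0
  · rw [card_eq_zero] at h0
    simp [h0]
  · exact card_filter_mul_le_sum X (fun u => #{v ∈ Y | ¬ T.adj u v}) q q' _ h h0

theorem card_right_bad_le {X Y : Finset (Fin n)} {q : ℕ} (q' : ℕ)
    (h : q * T.nonArcs X Y ≤ X.card * Y.card) :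
    q * #{v ∈ Y | #X < q' * #{u ∈ X | ¬ T.adj u v}} ≤ q' * Y.card := by
  rcases Nat.eq_zero_or_pos (#X) with h0 | h0
  · rw [card_eq_zero] at h0
    simp [h0]
  · rw [nonArcs_comm, mul_comm (#X)] at h
    exact card_filter_mul_le_sum Y (fun v => #{u ∈ X | ¬ T.adj u v}) q q' _ h h0

theorem nonArcs_le_of_left {X Y : Finset (Fin n)} {q : ℕ}
    (h : ∀ u ∈ X, q * #{v ∈ Y | ¬ T.adj u v} ≤ #Y) :
    q * T.nonArcs X Y ≤ X.card * Y.card := by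
  rw [nonArcs, mul_sum]
  exact (sum_le_card_nsmul _ _ _ h).trans_eq (smul_eq_mul _ _)

theorem nonArcs_le_of_right {X Y : Finset (Fin n)} {q : ℕ}
    (h : ∀ v ∈ Y, q * #{u ∈ X | ¬ T.adj u v} ≤ #X) :
    q * T.nonArcs X Y ≤ X.card * Y.card := by
  rw [nonArcs_comm, mul_sum, mul_comm (#X)]
  exact (sum_le_card_nsmul _ _ _ h).trans_eq (smul_eq_mul _ _)

/-- Greedy embedding into sets any two large subsets of which have many arcs in both
directions. -/
theorem exists_embedding_of_arcs [Nonempty (Fin n)] {h : ℕ} (H : Tournament h) (q m : ℕ)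
    (hq : 0 < q) (hm : 0 < m) (D : Finset (Fin h)) (W : Fin h → Finset (Fin n))
    (hW : ∀ x ∈ D, m * ((h + 1) * q) ^ D.card ≤ (W x).card)
    (hno : ∀ x y, x ≠ y → ∀ X ⊆ W x, ∀ Y ⊆ W y, m ≤ X.card → m ≤ Y.card →
      (∃ v ∈ X, #Y ≤ q * #{u ∈ Y | T.adj v u}) ∧ (∃ v ∈ X, #Y ≤ q * #{u ∈ Y | T.adj u v})) :
    ∃ f : Fin h → Fin n, (∀ x ∈ D, f x ∈ W x) ∧
      ∀ x ∈ D, ∀ y ∈ D, H.adj x y → T.adj (f x) (f y) := by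
  induction D using Finset.induction generalizing W with
  | empty => exact ⟨fun _ => Classical.arbitrary _, by simp, by simp⟩
  | insert a D ha ih =>
    rw [card_insert_of_notMem ha] at hW
    have hE : 1 ≤ (h + 1) * q := Nat.mul_pos (by omega) hq
    have hbig : ∀ x ∈ insert a D, m * (h + 1) ≤ (W x).card := fun x hx => by
      refine le_trans (Nat.mul_le_mul_left m ?_) (hW x hx)
      rw [pow_succ]
      calc h + 1 ≤ 1 * ((h + 1) * q) := by nlinarith
        _ ≤ _ := Nat.mul_le_mul_right _ (Nat.one_le_pow _ _ hE)
    let R : Fin h → Fin n → Fin n → Prop := fun y v u => if H.adj a y then T.adj v u else T.adj u v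
    let B : Fin h → Finset (Fin n) := fun y => {v ∈ W a | q * #{u ∈ W y | R y v u} < #(W y)}
    have hB : ∀ y ∈ D, #(B y) ≤ m := by
      intro y hy
      by_contra! hlt
      have hya : a ≠ y := fun e => ha (e ▸ hy)
      obtain ⟨⟨v, hv, hv'⟩, ⟨w, hw, hw'⟩⟩ := hno a y hya (B y) (filter_subset _ _) (W y) subset_rfl
        hlt.le ((Nat.le_mul_of_pos_right m (by omega)).trans (hbig y (mem_insert_of_mem hy)))
      by_cases hay : H.adj a y
      · simp only [B, R, hay, if_true, mem_filter] at hv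
        omega
      · simp only [B, R, hay, if_false, mem_filter] at hw
        omega
    have hDh : D.card ≤ h := by simpa using card_le_univ D
    have hU : #(D.biUnion B) < #(W a) := by
      calc #(D.biUnion B) ≤ D.card * m := card_biUnion_le_card_mul _ _ _ hB
        _ ≤ h * m := Nat.mul_le_mul_right _ hDh
        _ < m * (h + 1) := by nlinarith
        _ ≤ _ := hbig a (mem_insert_self _ _)
    obtain ⟨v, hva, hvB⟩ := exists_mem_notMem_of_card_lt_card hU
    have hvy : ∀ y ∈ D, #(W y) ≤ q * #{u ∈ W y | R y v u} := by
      intro y hy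
      by_contra! hlt
      exact hvB (mem_biUnion.2 ⟨y, hy, mem_filter.2 ⟨hva, hlt⟩⟩)
    obtain ⟨f, hfW, hf⟩ := ih (fun y => {u ∈ W y | R y v u})
      (fun y hy => by
        have h1 := hW y (mem_insert_of_mem hy)
        have h2 := hvy y hy
        rw [pow_succ] at h1
        refine Nat.le_of_mul_le_mul_left (le_trans ?_ h2) hq
        refine le_trans ?_ h1
        calc q * (m * ((h + 1) * q) ^ D.card) = m * (((h + 1) * q) ^ D.card * (1 * q)) := by ring
          _ ≤ _ := by gcongr; omega)
      (fun x y hxy X hX Y hY => hno x y hxy X (hX.trans (filter_subset _ _)) Y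
        (hY.trans (filter_subset _ _)))
    refine ⟨Function.update f a v, ?_, ?_⟩
    · intro x hx
      by_cases hxa : x = a
      · subst hxa; simpa using hva
      · rw [Function.update_of_ne hxa]
        exact (mem_filter.1 (hfW x ((mem_insert.1 hx).resolve_left hxa))).1
    · intro x hx y hy hxy
      by_cases hxa : x = a <;> by_cases hya : y = a
      · subst hxa hya
        exact absurd hxy (H.adj_irrefl _)
      · subst hxa
        have := (mem_filter.1 (hfW y ((mem_insert.1 hy).resolve_left hya))).2
        simpa [hya, R, hxy] using this
      · subst hya
        have := (mem_filter.1 (hfW x ((mem_insert.1 hx).resolve_left hxa))).2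
        simpa [hxa, R, H.asymm _ _ hxy] using this
      · rw [Function.update_of_ne hxa, Function.update_of_ne hya]
        exact hf x ((mem_insert.1 hx).resolve_left hxa) y ((mem_insert.1 hy).resolve_left hya) hxy

theorem contains_of_map {h : ℕ} {H : Tournament h} (f : Fin h → Fin n)
    (hf : ∀ x y, H.adj x y → T.adj (f x) (f y)) : T.Contains H := by
  have hinj : Function.Injective f := by
    intro x y hxy
    by_contra hne
    rcases H.total x y hne with h1 | h1
    · exact T.adj_irrefl (f y) (by simpa [hxy] using hf x y h1)
    · exact T.adj_irrefl (f y) (by simpa [hxy] using hf y x h1)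
  refine ⟨⟨f, hinj⟩, fun u v => ⟨hf u v, fun huv => ?_⟩⟩
  by_contra hn
  have hne : u ≠ v := by
    rintro rfl
    exact T.adj_irrefl _ huv
  exact T.asymm _ _ huv (hf v u (adj_of_not_adj hne hn))

/-- In a tournament avoiding `H`, every large vertex set contains two disjoint sets of linear
size with few arcs from the second to the first. -/
theorem exists_dense_pair {h : ℕ} (H : Tournament h) (q : ℕ) (hq : 0 < q) :
    ∃ c : ℕ, 0 < c ∧ ∀ {n : ℕ} (T : Tournament n), ¬ T.Contains H → ∀ s : Finset (Fin n), c ≤ s.card →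
      ∃ X ⊆ s, ∃ Y ⊆ s, Disjoint X Y ∧ s.card ≤ c * X.card ∧ s.card ≤ c * Y.card ∧
        q * T.nonArcs X Y ≤ X.card * Y.card := by
  set F := ((h + 1) * q) ^ h with hF
  have hFpos : 0 < F := by positivity
  refine ⟨2 * ((h + 1) * F), by positivity, fun {n} T hfree s hs => ?_⟩
  by_contra! hcon
  set E := (h + 1) * F with hE
  have hEpos : 0 < E := by positivity
  set m := s.card / E with hm
  have hmpos : 0 < m := Nat.div_pos (by omega) hEpos
  have hmE : m * E ≤ s.card := Nat.div_mul_le_self _ _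
  have hsm : ∀ X : Finset (Fin n), m ≤ X.card → s.card ≤ 2 * E * X.card := by
    intro X hX
    have := Nat.lt_mul_div_succ s.card hEpos
    rw [← hm] at this
    nlinarith
  have hne : Nonempty (Fin n) := by
    obtain ⟨v, -⟩ : s.Nonempty := card_pos.1 (by omega)
    exact ⟨v⟩
  obtain ⟨I, hI, hIR⟩ := exists_disjoint_subsets s h (m * F) (by rw [hE] at hmE; nlinarith)
  have hdis : ∀ x y : Fin h, x ≠ y → Disjoint (I x) (I y) := by
    intro x y hxy
    rcases lt_or_gt_of_ne hxy with hlt | hlt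
    · exact disjoint_left.2 fun v hv hv' => hIR x y hlt y.2 v hv v hv' rfl
    · exact disjoint_left.2 fun v hv hv' => hIR y x hlt x.2 v hv' v hv rfl
  obtain ⟨f, -, hf⟩ := exists_embedding_of_arcs (T := T) H q m hq hmpos univ (fun x => I x)
    (fun x _ => by rw [(hI x x.2).2, card_univ, Fintype.card_fin])
    (fun x y hxy X hX Y hY hXm hYm => by
      have hXs := hX.trans (hI x x.2).1
      have hYs := hY.trans (hI y y.2).1
      have hXY : Disjoint X Y := (hdis x y hxy).mono hX hY
      have hne : ∀ v ∈ X, ∀ u ∈ Y, v ≠ u := fun v hv u hu e => disjoint_left.1 hXY hv (e ▸ hu)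
      constructor
      · by_contra! hlt
        refine (hcon Y hYs X hXs hXY.symm (hsm _ hYm) (hsm _ hXm)).not_ge
          (nonArcs_le_of_right fun v hv => (hlt v hv).le.trans' ?_)
        refine Nat.mul_le_mul_left _ (card_le_card fun u hu => ?_)
        rw [mem_filter] at hu ⊢
        exact ⟨hu.1, adj_of_not_adj (hne v hv u hu.1).symm hu.2⟩
      · by_contra! hlt
        refine (hcon X hXs Y hYs hXY (hsm _ hXm) (hsm _ hYm)).not_ge
          (nonArcs_le_of_left fun v hv => (hlt v hv).le.trans' ?_)
        refine Nat.mul_le_mul_left _ (card_le_card fun u hu => ?_)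
        rw [mem_filter] at hu ⊢
        exact ⟨hu.1, adj_of_not_adj (hne v hv u hu.1) hu.2⟩)
  exact hfree (contains_of_map f fun x y => hf x (mem_univ _) y (mem_univ _))

/-- In a tournament avoiding `H`, every large vertex set contains a long sequence of disjoint
sets of linear size with few backward arcs between any two of them. -/
theorem exists_dense_sequence {h : ℕ} (H : Tournament h) (K q : ℕ) (hq : 0 < q) :
    ∃ c : ℕ, 0 < c ∧ ∀ {n : ℕ} (T : Tournament n), ¬ T.Contains H → ∀ s : Finset (Fin n),
      c ≤ s.card → ∃ A : ℕ → Finset (Fin n), (∀ i < K, A i ⊆ s ∧ s.card ≤ c * (A i).card) ∧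
        ∀ i j, i < j → j < K → Disjoint (A i) (A j) ∧
          q * T.nonArcs (A i) (A j) ≤ (A i).card * (A j).card := by
  induction K with
  | zero => exact ⟨1, one_pos, fun T _ s _ => ⟨fun _ => ∅, by simp, by simp⟩⟩
  | succ K ih =>
    obtain ⟨c, hc, ih⟩ := ih
    obtain ⟨d, hd, hpair⟩ := exists_dense_pair H (q * c) (Nat.mul_pos hq hc)
    refine ⟨c * d, Nat.mul_pos hc hd, fun T hfree s hs => ?_⟩
    obtain ⟨X, hXs, Y, hYs, hXY, hX, hY, hd⟩ :=
      hpair T hfree s ((Nat.le_mul_of_pos_left d hc).trans hs)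
    obtain ⟨A, hA, hAd⟩ := ih T hfree Y (by nlinarith)
    refine ⟨fun i => if i = 0 then X else A (i - 1), ?_, ?_⟩
    · intro i hi
      rcases Nat.eq_zero_or_pos i with rfl | hpos
      · exact ⟨by simpa using hXs, by simp only [if_true]; nlinarith⟩
      · simp only [hpos.ne', if_false]
        have := hA (i - 1) (by omega)
        exact ⟨this.1.trans hYs, by nlinarith⟩
    · intro i j hij hj
      have hj0 : j ≠ 0 := by omega
      simp only [hj0, if_false]
      rcases Nat.eq_zero_or_pos i with rfl | hpos
      · have hAj := hA (j - 1) (by omega)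
        simp only [if_true]
        refine ⟨hXY.mono_right hAj.1, Nat.le_of_mul_le_mul_left ?_ hc⟩
        calc c * (q * T.nonArcs X (A (j - 1))) = q * c * T.nonArcs X (A (j - 1)) := by ring
          _ ≤ q * c * T.nonArcs X Y := Nat.mul_le_mul_left _ (nonArcs_mono hAj.1)
          _ ≤ X.card * Y.card := hd
          _ ≤ X.card * (c * (A (j - 1)).card) := Nat.mul_le_mul_left _ hAj.2
          _ = _ := by ring
      · simp only [hpos.ne', if_false]
        exact hAd (i - 1) (j - 1) (by omega) (by omega)

end Density

section Blueprint

open scoped Classical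

variable {n : ℕ} {T : Tournament n}

/-- Subsets of `s` of proportion `1 / C` contain transitive sets of size almost `tr(s)`. -/
def Rich (T : Tournament n) (C : ℕ) (s : Finset (Fin n)) : Prop :=
  ∀ X ⊆ s, s.card ≤ C * X.card → C * T.trSizeOn s < C * T.trSizeOn X + T.trSizeOn s

theorem Rich.not_complete {C : ℕ} {s X Y : Finset (Fin n)} (h : T.Rich C s) (hC : 2 ≤ C)
    (hXs : X ⊆ s) (hYs : Y ⊆ s) (hX : s.card ≤ C * X.card) (hY : s.card ≤ C * Y.card) :
    ∃ x ∈ X, ∃ y ∈ Y, ¬ T.adj x y := by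
  by_contra! hc
  have h1 := h X hXs hX
  have h2 := h Y hYs hY
  have h3 := trSizeOn_add_le hXs hYs hc
  nlinarith

theorem Rich.not_complete_right {C : ℕ} {s X L : Finset (Fin n)} (h : T.Rich C s)
    (hXs : X ⊆ s) (hLs : L ⊆ s) (hX : s.card ≤ C * X.card) (hL : T.IsTransOn L)
    (hLc : T.trSizeOn s ≤ C * L.card) : ∃ x ∈ X, ∃ y ∈ L, ¬ T.adj x y := by
  by_contra! hc
  have h1 := h X hXs hX
  have h2 := hL.card_le subset_rfl
  have h3 := trSizeOn_add_le hXs hLs hc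
  nlinarith

theorem Rich.not_complete_left {C : ℕ} {s X L : Finset (Fin n)} (h : T.Rich C s)
    (hXs : X ⊆ s) (hLs : L ⊆ s) (hX : s.card ≤ C * X.card) (hL : T.IsTransOn L)
    (hLc : T.trSizeOn s ≤ C * L.card) : ∃ x ∈ X, ∃ y ∈ L, ¬ T.adj y x := by
  by_contra! hc
  have h1 := h X hXs hX
  have h2 := hL.card_le subset_rfl
  have h3 := trSizeOn_add_le hLs hXs fun y hy x hx => hc x hx y hy
  nlinarith

/-- `X` and `Y` are disjoint, and each vertex of `X` (resp. `Y`) is adjacent to (resp. from)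
all vertices of the other set up to a proportion `1 / q`. -/
def Dense (T : Tournament n) (q : ℕ) (X Y : Finset (Fin n)) : Prop :=
  Disjoint X Y ∧ (∀ u ∈ X, q * #{v ∈ Y | ¬ T.adj u v} ≤ #Y) ∧
    ∀ v ∈ Y, q * #{u ∈ X | ¬ T.adj u v} ≤ #X

theorem Dense.subset {q d : ℕ} {X Y X' Y' : Finset (Fin n)} (h : T.Dense (d * q) X Y)
    (hd : 0 < d) (hX : X' ⊆ X) (hY : Y' ⊆ Y) (hXc : #X ≤ d * #X') (hYc : #Y ≤ d * #Y') :
    T.Dense q X' Y' := by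
  refine ⟨h.1.mono hX hY, fun u hu => ?_, fun v hv => ?_⟩
  · refine Nat.le_of_mul_le_mul_left ?_ hd
    rw [← mul_assoc]
    exact ((Nat.mul_le_mul_left _ (card_le_card (filter_subset_filter _ hY))).trans
      (h.2.1 u (hX hu))).trans hYc
  · refine Nat.le_of_mul_le_mul_left ?_ hd
    rw [← mul_assoc]
    exact ((Nat.mul_le_mul_left _ (card_le_card (filter_subset_filter _ hX))).trans
      (h.2.2 v (hY hv))).trans hXc

/-- Removing atypical vertices turns density on average into density at each vertex. -/
theorem exists_dense_subsets {ι : Type*} (J : Finset ι) (q : ℕ) (hq : 0 < q)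
    (S : ι → Finset (Fin n)) (rel : ι → ι → Prop)
    (h : ∀ i ∈ J, ∀ j ∈ J, rel i j → Disjoint (S i) (S j) ∧
      8 * J.card * q * T.nonArcs (S i) (S j) ≤ #(S i) * #(S j)) :
    ∃ S' : ι → Finset (Fin n), (∀ i ∈ J, S' i ⊆ S i ∧ #(S i) ≤ 2 * #(S' i)) ∧
      ∀ i ∈ J, ∀ j ∈ J, rel i j → T.Dense q (S' i) (S' j) := by
  let B : ι → ι → Finset (Fin n) := fun i j =>
    {u ∈ S i | rel i j ∧ #(S j) < 2 * q * #{v ∈ S j | ¬ T.adj u v}} ∪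
    {v ∈ S i | rel j i ∧ #(S j) < 2 * q * #{u ∈ S j | ¬ T.adj u v}}
  have hB : ∀ i ∈ J, ∀ j ∈ J, 2 * J.card * #(B i j) ≤ #(S i) := by
    intro i hi j hj
    have hcancel : ∀ b : ℕ, 8 * J.card * q * b ≤ 2 * q * #(S i) → 4 * J.card * b ≤ #(S i) := by
      intro b hb
      refine Nat.le_of_mul_le_mul_left ?_ (Nat.mul_pos two_pos hq)
      calc _ = 8 * J.card * q * b := by ring
        _ ≤ _ := hb
    have h1 : 4 * J.card * #{u ∈ S i | rel i j ∧ #(S j) < 2 * q * #{v ∈ S j | ¬ T.adj u v}}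
        ≤ #(S i) := by
      by_cases hr : rel i j
      · simpa [hr] using hcancel _ (card_left_bad_le (2 * q) (h i hi j hj hr).2)
      · simp [hr]
    have h2 : 4 * J.card * #{v ∈ S i | rel j i ∧ #(S j) < 2 * q * #{u ∈ S j | ¬ T.adj u v}}
        ≤ #(S i) := by
      by_cases hr : rel j i
      · simpa [hr] using hcancel _ (card_right_bad_le (2 * q) (h j hj i hi hr).2)
      · simp [hr]
    have h3 := Nat.mul_le_mul_left (4 * J.card) (card_union_le
      {u ∈ S i | rel i j ∧ #(S j) < 2 * q * #{v ∈ S j | ¬ T.adj u v}}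
      {v ∈ S i | rel j i ∧ #(S j) < 2 * q * #{u ∈ S j | ¬ T.adj u v}})
    have h4 : 4 * J.card * #(B i j) ≤ 2 * #(S i) := by
      rw [mul_add] at h3
      exact h3.trans (by omega)
    linarith
  have hhalf : ∀ i ∈ J, #(S i) ≤ 2 * #(S i \ J.biUnion (B i)) := by
    intro i hi
    have hJ : 0 < J.card := card_pos.2 ⟨i, hi⟩
    have h1 : 2 * #(J.biUnion (B i)) ≤ #(S i) := by
      refine Nat.le_of_mul_le_mul_left ?_ hJ
      calc J.card * (2 * #(J.biUnion (B i))) ≤ J.card * (2 * ∑ j ∈ J, #(B i j)) := by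
            gcongr; exact card_biUnion_le
        _ = ∑ j ∈ J, 2 * J.card * #(B i j) := by rw [← mul_sum]; ring
        _ ≤ J.card * #(S i) := (sum_le_card_nsmul _ _ _ (hB i hi)).trans_eq (smul_eq_mul _ _)
    have h2 := le_card_sdiff (J.biUnion (B i)) (S i)
    omega
  refine ⟨fun i => S i \ J.biUnion (B i), fun i hi => ⟨sdiff_subset, hhalf i hi⟩, ?_⟩
  intro i hi j hj hr
  refine Dense.subset (d := 1) (X := S i \ J.biUnion (B i)) (Y := S j \ J.biUnion (B j)) ?_
    one_pos subset_rfl subset_rfl (by simp) (by simp)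
  refine ⟨(h i hi j hj hr).1.mono sdiff_subset sdiff_subset, fun u hu => ?_, fun v hv => ?_⟩
  · rw [mem_sdiff] at hu
    have hu' : ¬ (#(S j) < 2 * q * #{v ∈ S j | ¬ T.adj u v}) := fun hlt =>
      hu.2 (mem_biUnion.2 ⟨j, hj, mem_union_left _ (mem_filter.2 ⟨hu.1, hr, hlt⟩)⟩)
    have h1 : #{v ∈ S j \ J.biUnion (B j) | ¬ T.adj u v} ≤ #{v ∈ S j | ¬ T.adj u v} :=
      card_le_card (filter_subset_filter _ sdiff_subset)
    have := hhalf j hj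
    nlinarith
  · rw [mem_sdiff] at hv
    have hv' : ¬ (#(S i) < 2 * q * #{u ∈ S i | ¬ T.adj u v}) := fun hlt =>
      hv.2 (mem_biUnion.2 ⟨i, hi, mem_union_right _ (mem_filter.2 ⟨hv.1, hr, hlt⟩)⟩)
    have h1 : #{u ∈ S i \ J.biUnion (B i) | ¬ T.adj u v} ≤ #{u ∈ S i | ¬ T.adj u v} :=
      card_le_card (filter_subset_filter _ sdiff_subset)
    have := hhalf i hi
    nlinarith

/-- A sequence of `K` pairs of vertex sets `S i false` (of linear size) and `S i true`
(transitive, of size linear in `tr(s)`), consecutively dense. -/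
structure IsBlueprint (T : Tournament n) (s : Finset (Fin n)) (K c q : ℕ)
    (S : ℕ → Bool → Finset (Fin n)) : Prop where
  subset : ∀ i < K, ∀ b, S i b ⊆ s
  card_le : ∀ i < K, s.card ≤ c * #(S i false)
  trans : ∀ i < K, T.IsTransOn (S i true)
  trSize_le : ∀ i < K, T.trSizeOn s ≤ c * #(S i true)
  dense : ∀ i j, i < j → j < K → ∀ b b', T.Dense q (S i b) (S j b')

theorem IsBlueprint.refine {s : Finset (Fin n)} {K c q d : ℕ} {S S' : ℕ → Bool → Finset (Fin n)}
    (h : T.IsBlueprint s K c (d * q) S) (hd : 0 < d)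
    (hS : ∀ i < K, ∀ b, S' i b ⊆ S i b ∧ #(S i b) ≤ d * #(S' i b)) :
    T.IsBlueprint s K (c * d) q S' where
  subset i hi b := (hS i hi b).1.trans (h.subset i hi b)
  card_le i hi := (h.card_le i hi).trans
    (by rw [mul_assoc]; exact Nat.mul_le_mul_left _ (hS i hi false).2)
  trans i hi := (h.trans i hi).subset (hS i hi true).1
  trSize_le i hi := (h.trSize_le i hi).trans
    (by rw [mul_assoc]; exact Nat.mul_le_mul_left _ (hS i hi true).2)
  dense i j hij hj b b' := (h.dense i j hij hj b b').subset hd (hS i (hij.trans hj) b).1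
    (hS j hj b').1 (hS i (hij.trans hj) b).2 (hS j hj b').2

theorem exists_transitive_sequence {s : Finset (Fin n)} {K c q C : ℕ} (hq : 0 < q)
    {A : ℕ → Finset (Fin n)} (hA : ∀ i < K, A i ⊆ s ∧ s.card ≤ c * #(A i))
    (hd : ∀ i j, i < j → j < K → T.Dense (2 * K * q) (A i) (A j))
    (hR : T.Rich C s) (hC : 2 ≤ C) (hcC : 2 * c ≤ C) (m : ℕ) (hm : m ≤ K) :
    ∃ L : ℕ → Finset (Fin n),
      (∀ i < m, L i ⊆ A i ∧ T.IsTransOn (L i) ∧ T.trSizeOn s ≤ 2 * #(L i)) ∧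
      ∀ i j, i < j → j < m → ∀ v ∈ L j, q * #{u ∈ L i | ¬ T.adj u v} ≤ #(L i) := by
  induction m with
  | zero => exact ⟨fun _ => ∅, by simp, by simp⟩
  | succ m ih =>
    obtain ⟨L, hL, hLd⟩ := ih (by omega)
    let B : ℕ → Finset (Fin n) := fun i => {v ∈ A m | #(L i) < q * #{u ∈ L i | ¬ T.adj u v}}
    have hB : ∀ i ∈ range m, 2 * K * #(B i) ≤ #(A m) := by
      intro i hi
      rw [mem_range] at hi
      have h1 := card_right_bad_le q (nonArcs_le_of_left (T := T) (X := L i) (Y := A m)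
        (q := 2 * K * q) fun u hu => (hd i m hi (by omega)).2.1 u ((hL i hi).1 hu))
      refine Nat.le_of_mul_le_mul_left ?_ hq
      calc q * (2 * K * #(B i)) = 2 * K * q * #(B i) := by ring
        _ ≤ _ := h1
    have h1 : 2 * #((range m).biUnion B) ≤ #(A m) := by
      refine Nat.le_of_mul_le_mul_left ?_ (show 0 < K by omega)
      calc K * (2 * #((range m).biUnion B)) ≤ K * (2 * ∑ j ∈ range m, #(B j)) := by
            gcongr; exact card_biUnion_le
        _ = ∑ j ∈ range m, 2 * K * #(B j) := by rw [← mul_sum]; ring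
        _ ≤ m * #(A m) := by
            simpa using sum_le_card_nsmul _ _ _ hB
        _ ≤ K * #(A m) := Nat.mul_le_mul_right _ (by omega)
    have h2 := le_card_sdiff ((range m).biUnion B) (A m)
    have hAm := hA m (by omega)
    obtain ⟨M, hMG, hMt, hMc⟩ := T.exists_isTransOn_card_eq (A m \ (range m).biUnion B)
    have h3 := hR _ (sdiff_subset.trans hAm.1 : A m \ (range m).biUnion B ⊆ s) (by
      calc s.card ≤ c * #(A m) := hAm.2
        _ ≤ c * (2 * #(A m \ (range m).biUnion B)) := Nat.mul_le_mul_left _ (by omega)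
        _ = 2 * c * #(A m \ (range m).biUnion B) := by ring
        _ ≤ _ := Nat.mul_le_mul_right _ hcC)
    have h4 : T.trSizeOn s ≤ 2 * #M := by
      rw [hMc]
      nlinarith
    refine ⟨Function.update L m M, ?_, ?_⟩
    · intro i hi
      by_cases him : i = m
      · subst him
        simp only [Function.update_self]
        exact ⟨hMG.trans sdiff_subset, hMt, h4⟩
      · rw [Function.update_of_ne him]
        exact hL i (by omega)
    · intro i j hij hj v hv
      rw [Function.update_of_ne (by omega : i ≠ m)]
      by_cases hjm : j = m
      · subst hjm
        rw [Function.update_self] at hv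
        have hv := mem_sdiff.1 (hMG hv)
        by_contra! hlt
        exact hv.2 (mem_biUnion.2 ⟨i, mem_range.2 hij, mem_filter.2 ⟨hv.1, hlt⟩⟩)
      · rw [Function.update_of_ne hjm] at hv
        exact hLd i j hij (by omega) v hv

theorem exists_isBlueprint {h : ℕ} (H : Tournament h) (K q : ℕ) (hK : 0 < K) (hq : 0 < q) :
    ∃ c : ℕ, 0 < c ∧ ∀ {n : ℕ} (T : Tournament n), ¬ T.Contains H → ∀ s : Finset (Fin n),
      c ≤ s.card → ∀ C, c ≤ C → T.Rich C s → ∃ S, T.IsBlueprint s K c q S := by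
  set q₁ := 8 * (2 * K) * q with hq₁
  have hq₁pos : 0 < q₁ := by positivity
  obtain ⟨c, hc, hseq⟩ := exists_dense_sequence H K (8 * K * (2 * K * q₁)) (by positivity)
  refine ⟨4 * c, by positivity, fun T hfree s hs C hC hR => ?_⟩
  obtain ⟨A₀, hA₀, hA₀d⟩ := hseq T hfree s (by omega)
  obtain ⟨A, hA, hAd⟩ := exists_dense_subsets (T := T) (range K) (2 * K * q₁) (by positivity) A₀
    (· < ·) (fun i _ j hj hij => by
      rw [card_range]
      exact hA₀d i j hij (mem_range.1 hj))
  simp only [mem_range] at hA hAd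
  have hA' : ∀ i < K, A i ⊆ s ∧ s.card ≤ (2 * c) * #(A i) := fun i hi =>
    ⟨(hA i hi).1.trans (hA₀ i hi).1, by nlinarith [(hA₀ i hi).2, (hA i hi).2]⟩
  obtain ⟨L, hL, hLd⟩ := exists_transitive_sequence hq₁pos hA'
    (fun i j hij hj => hAd i (hij.trans hj) j hj hij) hR (by omega) (by omega) K le_rfl
  have hweak : ∀ a b : ℕ, 2 * K * q₁ * a ≤ b → q₁ * a ≤ b := fun a b hab =>
    le_trans (Nat.mul_le_mul_right _ (Nat.le_mul_of_pos_left _ (by positivity))) hab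
  obtain ⟨S, hS, hSd⟩ := exists_dense_subsets (T := T) (range K ×ˢ (univ : Finset Bool)) q hq
    (fun p => if p.2 then L p.1 else A p.1) (fun p p' => p.1 < p'.1) (by
      rintro ⟨i, b⟩ hi ⟨j, b'⟩ hj hij
      simp only [mem_product, mem_range, mem_univ, and_true] at hi hj hij
      have hdij := hAd i hi j hj hij
      have hcard : 8 * #(range K ×ˢ (univ : Finset Bool)) * q = q₁ := by
        rw [card_product, card_range, card_univ, Fintype.card_bool, hq₁]
        ring
      rw [hcard]
      cases b <;> cases b'
      · exact ⟨hdij.1, nonArcs_le_of_left fun u hu => hweak _ _ (hdij.2.1 u hu)⟩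
      · exact ⟨hdij.1.mono_right (hL j hj).1, nonArcs_le_of_right fun v hv =>
          hweak _ _ (hdij.2.2 v ((hL j hj).1 hv))⟩
      · exact ⟨hdij.1.mono_left (hL i hi).1, nonArcs_le_of_left fun u hu =>
          hweak _ _ (hdij.2.1 u ((hL i hi).1 hu))⟩
      · exact ⟨hdij.1.mono (hL i hi).1 (hL j hj).1, nonArcs_le_of_right (hLd i j hij hj)⟩)
  simp only [mem_product, mem_range, mem_univ, and_true, Prod.forall] at hS hSd
  refine ⟨fun i b => S (i, b), ?_, ?_, ?_, ?_, ?_⟩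
  · intro i hi b
    refine (hS i b hi).1.trans ?_
    cases b
    · exact (hA' i hi).1
    · exact (hL i hi).1.trans (hA' i hi).1
  · intro i hi
    have h1 := (hS i false hi).2
    have h2 := (hA' i hi).2
    simp only [Bool.false_eq_true, if_false] at h1
    nlinarith
  · intro i hi
    exact (hL i hi).2.1.subset (by simpa using (hS i true hi).1)
  · intro i hi
    have h1 := (hS i true hi).2
    have h2 := (hL i hi).2.2
    simp only [if_true] at h1
    nlinarith
  · intro i j hij hj b b'
    exact hSd i b (hij.trans hj) j b' hj hij

end Blueprint

section Embedding

open scoped Classical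

variable {n h : ℕ} {T : Tournament n} {H : Tournament h} {θ : Equiv.Perm (Fin h)}

theorem pos_injective (θ : Equiv.Perm (Fin h)) : Function.Injective (pos θ) :=
  θ.symm.injective

theorem trSizeOn_le_card (T : Tournament n) (s : Finset (Fin n)) : T.trSizeOn s ≤ #s := by
  obtain ⟨t, hts, -, htc⟩ := T.exists_isTransOn_card_eq s
  exact htc ▸ card_le_card hts

/-- The sets `Z x` are candidate sets for the images of the vertices `x`: parts of proportion
`1 / d` of the members of `S` prescribed by `slot` and `leaf`, such that those within a common
member of `S` are consecutive in a transitive set. -/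
def IsFamily (T : Tournament n) (θ : Equiv.Perm (Fin h)) (leaf : Fin h → Bool) (slot : Fin h → ℕ)
    (S : ℕ → Bool → Finset (Fin n)) (d : ℕ) (Z : Fin h → Finset (Fin n)) : Prop :=
  (∀ x, Z x ⊆ S (slot x) (leaf x) ∧ #(S (slot x) (leaf x)) ≤ d * #(Z x)) ∧
    ∀ x y, pos θ x < pos θ y → slot x = slot y → ∀ a ∈ Z x, ∀ b ∈ Z y, T.adj a b

/-- `slot` is weakly increasing along `θ`, and only leaves share a slot. -/
def IsLayout (θ : Equiv.Perm (Fin h)) (leaf : Fin h → Bool) (slot : Fin h → ℕ) (K : ℕ) : Prop :=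
  (∀ x, slot x < K) ∧ ∀ x y, pos θ x < pos θ y →
    slot x < slot y ∨ (slot x = slot y ∧ leaf x = true ∧ leaf y = true)

variable {leaf : Fin h → Bool} {slot : Fin h → ℕ} {K c q : ℕ} {s : Finset (Fin n)}
  {S : ℕ → Bool → Finset (Fin n)} {Z : Fin h → Finset (Fin n)}

theorem IsBlueprint.exists_isFamily (hS : T.IsBlueprint s K c q S) (hc : 0 < c)
    (hlay : IsLayout θ leaf slot K) (htr : c * (h + 1) ≤ T.trSizeOn s) :
    ∃ Z, IsFamily T θ leaf slot S (2 * (h + 1)) Z := by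
  have hint : ∀ i, ∃ I : ℕ → Finset (Fin n), i < K →
      (∀ k < h + 1, I k ⊆ S i true ∧ #(S i true) ≤ 2 * (h + 1) * #(I k)) ∧
      ∀ k l, k < l → l < h + 1 → ∀ x ∈ I k, ∀ y ∈ I l, T.adj x y := by
    intro i
    by_cases hi : i < K
    · obtain ⟨I, hI⟩ := (hS.trans i hi).exists_intervals (h + 1)
        (Nat.le_of_mul_le_mul_left (htr.trans (hS.trSize_le i hi)) hc)
      exact ⟨I, fun _ => hI⟩
    · exact ⟨fun _ => ∅, fun h => absurd h hi⟩
  choose I hI using hint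
  refine ⟨fun x => if leaf x = true then I (slot x) (pos θ x) else S (slot x) (leaf x), ?_, ?_⟩
  · intro x
    by_cases hx : leaf x = true
    · simp only [hx, if_true]
      exact (hI _ (hlay.1 x)).1 _ (by omega)
    · simp only [hx]
      exact ⟨subset_rfl, Nat.le_mul_of_pos_left _ (by omega)⟩
  · intro x y hxy hslot a ha b hb
    rcases hlay.2 x y hxy with hlt | ⟨-, hx, hy⟩
    · omega
    · simp only [hx, hy, if_true] at ha hb
      rw [← hslot] at hb
      exact (hI _ (hlay.1 x)).2 _ _ hxy (by omega) a ha b hb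

theorem IsBlueprint.family_nonempty (hS : T.IsBlueprint s K c q S) (hc : 0 < c)
    (hlay : IsLayout θ leaf slot K) (htr : c * (h + 1) ≤ T.trSizeOn s) {d : ℕ}
    (hZ : IsFamily T θ leaf slot S d Z) (x : Fin h) : (Z x).Nonempty := by
  have hpos : 0 < #(S (slot x) (leaf x)) := by
    refine Nat.pos_of_mul_pos_left (a := c) (Nat.lt_of_lt_of_le (Nat.mul_pos hc h.succ_pos) ?_)
    cases hx : leaf x
    · exact (htr.trans (T.trSizeOn_le_card s)).trans (hS.card_le _ (hlay.1 x))
    · exact htr.trans (hS.trSize_le _ (hlay.1 x))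
  exact card_pos.1 (Nat.pos_of_mul_pos_left (hpos.trans_le (hZ.1 x).2))

/-- `T` contains `H` if the groups of a vertex partition without backward arcs between
different groups can be embedded one at a time. -/
theorem IsBlueprint.contains {ι : Type*} [Fintype ι]
    (hS : T.IsBlueprint s K c (2 * (h + 1) * (2 * (h + 1))) S) (hc : 0 < c)
    (hlay : IsLayout θ leaf slot K) (htr : c * (h + 1) ≤ T.trSizeOn s)
    (P : ι → Finset (Fin h)) (cover : ∀ x, ∃ i, x ∈ P i)
    (disj : ∀ i j, i ≠ j → Disjoint (P i) (P j))
    (back : ∀ u v, H.Backward θ u v → ∃ i, u ∈ P i ∧ v ∈ P i)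
    (group : ∀ Z, IsFamily T θ leaf slot S (2 * (2 * (h + 1))) Z → ∀ i,
      ∃ f : Fin h → Fin n, (∀ x ∈ P i, f x ∈ Z x) ∧
        ∀ x ∈ P i, ∀ y ∈ P i, H.adj x y → T.adj (f x) (f y)) :
    T.Contains H := by
  obtain ⟨Z, hZ⟩ := hS.exists_isFamily hc hlay htr
  set E := 2 * (h + 1) with hE
  have hdense : ∀ x y, pos θ x < pos θ y →
      (∀ a ∈ Z x, E * #{b ∈ Z y | ¬ T.adj a b} ≤ #(Z y)) ∧
      (∀ b ∈ Z y, E * #{a ∈ Z x | ¬ T.adj a b} ≤ #(Z x)) := by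
    intro x y hxy
    rcases hlay.2 x y hxy with hlt | ⟨heq, -, -⟩
    · exact ((hS.dense _ _ hlt (hlay.1 y) _ _).subset (by omega) (hZ.1 x).1 (hZ.1 y).1
        (hZ.1 x).2 (hZ.1 y).2).2
    · have hcomp := hZ.2 x y hxy heq
      constructor
      · intro a ha
        rw [filter_false_of_mem fun b hb => not_not.2 (hcomp a ha b hb)]
        simp
      · intro b hb
        rw [filter_false_of_mem fun a ha => not_not.2 (hcomp a ha b hb)]
        simp
  have hforward : ∀ i j, i ≠ j → ∀ x ∈ P i, ∀ y ∈ P j, H.adj x y → pos θ x < pos θ y := by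
    intro i j hij x hx y hy hxy
    by_contra hlt
    have hne : pos θ y ≠ pos θ x := fun e =>
      H.adj_irrefl x (by rwa [pos_injective θ e] at hxy)
    obtain ⟨k, hkx, hky⟩ := back x y ⟨hxy, lt_of_le_of_ne (not_lt.1 hlt) hne⟩
    have hik : i = k := by
      by_contra hne
      exact disjoint_left.1 (disj i k hne) hx hkx
    have hjk : j = k := by
      by_contra hne
      exact disjoint_left.1 (disj j k hne) hy hky
    exact hij (hik.trans hjk.symm)
  suffices hmain : ∀ J : Finset ι, ∃ f : Fin h → Fin n, (∀ i ∈ J, ∀ x ∈ P i, f x ∈ Z x) ∧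
      ∀ i ∈ J, ∀ j ∈ J, ∀ x ∈ P i, ∀ y ∈ P j, H.adj x y → T.adj (f x) (f y) by
    obtain ⟨f, -, hf⟩ := hmain univ
    refine contains_of_map f fun x y hxy => ?_
    obtain ⟨i, hi⟩ := cover x
    obtain ⟨j, hj⟩ := cover y
    exact hf i (mem_univ _) j (mem_univ _) x hi y hj hxy
  intro J
  induction J using Finset.induction with
  | empty =>
    exact ⟨fun x => (hS.family_nonempty hc hlay htr hZ x).choose, by simp, by simp⟩
  | insert k J hk ih =>
    obtain ⟨f, hfZ, hf⟩ := ih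
    let D := J.biUnion P
    have hfD : ∀ x ∈ D, f x ∈ Z x := by
      intro x hx
      obtain ⟨i, hi, hxi⟩ := mem_biUnion.1 hx
      exact hfZ i hi x hxi
    let B : Fin h → Fin h → Finset (Fin n) := fun y x =>
      {u ∈ Z y | (pos θ x < pos θ y ∧ ¬ T.adj (f x) u) ∨ (pos θ y < pos θ x ∧ ¬ T.adj u (f x))}
    have hB : ∀ y, ∀ x ∈ D, E * #(B y x) ≤ #(Z y) := by
      intro y x hx
      rcases lt_trichotomy (pos θ x) (pos θ y) with hlt | heq | hlt
      · simpa [B, hlt, hlt.not_gt] using (hdense x y hlt).1 _ (hfD x hx)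
      · simp [B, heq]
      · simpa [B, hlt, hlt.not_gt] using (hdense y x hlt).2 _ (hfD x hx)
    have hhalf : ∀ y, #(Z y) ≤ 2 * #(Z y \ D.biUnion (B y)) := by
      intro y
      have hDh : D.card ≤ h := by simpa using card_le_univ D
      have h1 : E * #(D.biUnion (B y)) ≤ (h + 1) * #(Z y) :=
        calc E * #(D.biUnion (B y)) ≤ E * ∑ x ∈ D, #(B y x) :=
              Nat.mul_le_mul_left _ card_biUnion_le
          _ = ∑ x ∈ D, E * #(B y x) := mul_sum _ _ _
          _ ≤ D.card * #(Z y) := (sum_le_card_nsmul _ _ _ (hB y)).trans_eq (smul_eq_mul _ _)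
          _ ≤ _ := Nat.mul_le_mul_right _ (by omega)
      have h2 : 2 * #(D.biUnion (B y)) ≤ #(Z y) :=
        Nat.le_of_mul_le_mul_left (by rw [hE] at h1; linarith) h.succ_pos
      have h3 := le_card_sdiff (D.biUnion (B y)) (Z y)
      omega
    have hZ' : IsFamily T θ leaf slot S (2 * E) fun y => Z y \ D.biUnion (B y) := by
      refine ⟨fun x => ⟨sdiff_subset.trans (hZ.1 x).1, ?_⟩, fun x y hxy hs a ha b hb =>
        hZ.2 x y hxy hs a (mem_sdiff.1 ha).1 b (mem_sdiff.1 hb).1⟩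
      calc _ ≤ E * #(Z x) := (hZ.1 x).2
        _ ≤ E * (2 * #(Z x \ D.biUnion (B x))) := Nat.mul_le_mul_left _ (hhalf x)
        _ = _ := by ring
    obtain ⟨g, hgZ, hg⟩ := group _ hZ' k
    have hgood : ∀ y ∈ P k, ∀ x ∈ D, (pos θ x < pos θ y → T.adj (f x) (g y)) ∧
        (pos θ y < pos θ x → T.adj (g y) (f x)) := by
      intro y hy x hx
      have hgy := mem_sdiff.1 (hgZ y hy)
      constructor
      · intro hlt
        by_contra hn
        exact hgy.2 (mem_biUnion.2 ⟨x, hx, mem_filter.2 ⟨hgy.1, Or.inl ⟨hlt, hn⟩⟩⟩)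
      · intro hlt
        by_contra hn
        exact hgy.2 (mem_biUnion.2 ⟨x, hx, mem_filter.2 ⟨hgy.1, Or.inr ⟨hlt, hn⟩⟩⟩)
    have hnot : ∀ j ∈ J, ∀ x ∈ P j, x ∉ P k := fun j hj x hx hxk =>
      disjoint_left.1 (disj j k fun e => hk (e ▸ hj)) hx hxk
    refine ⟨fun x => if x ∈ P k then g x else f x, ?_, ?_⟩
    · intro i hi x hx
      rcases mem_insert.1 hi with rfl | hi
      · simpa [hx] using (mem_sdiff.1 (hgZ x hx)).1
      · simpa [hnot i hi x hx] using hfZ i hi x hx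
    · intro i hi j hj x hx y hy hxy
      rcases mem_insert.1 hi with hik | hiJ <;> rcases mem_insert.1 hj with hjk | hjJ
      · rw [hik] at hx
        rw [hjk] at hy
        simpa [hx, hy] using hg x hx y hy hxy
      · rw [hik] at hx
        have hlt := hforward k j (fun e => hk (e ▸ hjJ)) x hx y hy hxy
        simpa [hx, hnot j hjJ y hy] using (hgood x hx y (mem_biUnion.2 ⟨j, hjJ, hy⟩)).2 hlt
      · rw [hjk] at hy
        have hlt := hforward i k (fun e => hk (e ▸ hiJ)) x hx y hy hxy
        simpa [hy, hnot i hiJ x hx] using (hgood y hy x (mem_biUnion.2 ⟨i, hiJ, hx⟩)).1 hlt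
      · simpa [hnot i hiJ x hx, hnot j hjJ y hy] using hf i hiJ j hjJ x hx y hy hxy

end Embedding

section Slots

open scoped Classical

variable {h : ℕ} (θ : Equiv.Perm (Fin h)) (D : Finset (Fin h))

/-- The members of `D` receive odd values, and the maximal runs of other vertices between them
receive even values. -/
noncomputable def slotOf (x : Fin h) : ℕ :=
  #{z ∈ D | pos θ z ≤ pos θ x} + #{z ∈ D | pos θ z < pos θ x}

theorem slotOf_le (x : Fin h) : slotOf θ D x ≤ 2 * h := by
  have hD : #D ≤ h := by simpa using card_le_univ D
  have h1 : #{z ∈ D | pos θ z ≤ pos θ x} ≤ h := (card_le_card (filter_subset _ _)).trans hD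
  have h2 : #{z ∈ D | pos θ z < pos θ x} ≤ h := (card_le_card (filter_subset _ _)).trans hD
  unfold slotOf
  linarith

variable {θ D}

theorem slotOf_mono {x y : Fin h} (hxy : pos θ x ≤ pos θ y) : slotOf θ D x ≤ slotOf θ D y :=
  add_le_add (card_le_card fun z hz => by
      rw [mem_filter] at hz ⊢; exact ⟨hz.1, hz.2.trans hxy⟩)
    (card_le_card fun z hz => by rw [mem_filter] at hz ⊢; exact ⟨hz.1, hz.2.trans_le hxy⟩)

theorem slotOf_lt {x y : Fin h} (hxy : pos θ x < pos θ y) (hD : x ∈ D ∨ y ∈ D) :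
    slotOf θ D x < slotOf θ D y := by
  have h1 : #{z ∈ D | pos θ z ≤ pos θ x} ≤ #{z ∈ D | pos θ z ≤ pos θ y} :=
    card_le_card fun z hz => by rw [mem_filter] at hz ⊢; exact ⟨hz.1, hz.2.trans hxy.le⟩
  have h2 : #{z ∈ D | pos θ z < pos θ x} ≤ #{z ∈ D | pos θ z < pos θ y} :=
    card_le_card fun z hz => by rw [mem_filter] at hz ⊢; exact ⟨hz.1, hz.2.trans hxy⟩
  rcases hD with hx | hy
  · refine add_lt_add_of_le_of_lt h1 (card_lt_card ?_)
    rw [ssubset_iff_of_subset fun z hz => by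
      rw [mem_filter] at hz ⊢; exact ⟨hz.1, hz.2.trans hxy⟩]
    exact ⟨x, by simp [hx, hxy], by simp⟩
  · refine add_lt_add_of_lt_of_le (card_lt_card ?_) h2
    rw [ssubset_iff_of_subset fun z hz => by
      rw [mem_filter] at hz ⊢; exact ⟨hz.1, hz.2.trans hxy.le⟩]
    exact ⟨y, by simp [hy], by simp [hxy]⟩

theorem slotOf_eq_of_le {x y : Fin h} (hxy : pos θ x ≤ pos θ y) (hx : x ∉ D) (hy : y ∉ D)
    (hz : ∀ z ∈ D, ¬ (pos θ x < pos θ z ∧ pos θ z < pos θ y)) :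
    slotOf θ D x = slotOf θ D y := by
  have hkey : ∀ z ∈ D, pos θ z ≤ pos θ y → pos θ z < pos θ x := by
    intro z hzD hzy
    have hzx : pos θ z ≠ pos θ x := fun e => hx (pos_injective θ e ▸ hzD)
    have hzy' : pos θ z ≠ pos θ y := fun e => hy (pos_injective θ e ▸ hzD)
    by_contra hn
    exact hz z hzD ⟨lt_of_le_of_ne (not_lt.1 hn) hzx.symm, lt_of_le_of_ne hzy hzy'⟩
  refine le_antisymm (slotOf_mono hxy) (add_le_add ?_ ?_)
  · refine card_le_card fun z hz => ?_
    rw [mem_filter] at hz ⊢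
    exact ⟨hz.1, (hkey z hz.1 hz.2).le⟩
  · refine card_le_card fun z hz => ?_
    rw [mem_filter] at hz ⊢
    exact ⟨hz.1, hkey z hz.1 hz.2.le⟩

theorem slotOf_eq_of_not_betweenSet {L : Finset (Fin h)} (hL : ∀ x ∈ L, x ∉ D)
    (hz : ∀ z ∈ D, ¬ BetweenSet θ L z) {x y : Fin h} (hx : x ∈ L) (hy : y ∈ L) :
    slotOf θ D x = slotOf θ D y := by
  rcases le_total (pos θ x) (pos θ y) with hxy | hxy
  · exact slotOf_eq_of_le hxy (hL x hx) (hL y hy) fun z hzD hlt => hz z hzD ⟨x, hx, y, hy, hlt⟩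
  · exact (slotOf_eq_of_le hxy (hL y hy) (hL x hx)
      fun z hzD hlt => hz z hzD ⟨y, hy, x, hx, hlt⟩).symm

theorem isLayout_comp_slotOf {φ : ℕ → ℕ} {K : ℕ} (hK : ∀ t ≤ 2 * h, φ t < K)
    (hφ : ∀ t t', t < t' → t' ≤ 2 * h → φ t < φ t') :
    IsLayout θ (fun x => decide (x ∉ D)) (fun x => φ (slotOf θ D x)) K := by
  refine ⟨fun x => hK _ (slotOf_le θ D x), fun x y hxy => ?_⟩
  by_cases hD : x ∈ D ∨ y ∈ D
  · exact Or.inl (hφ _ _ (slotOf_lt hxy hD) (slotOf_le θ D y))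
  · rw [not_or] at hD
    rcases (slotOf_mono (D := D) hxy.le).lt_or_eq with hlt | heq
    · exact Or.inl (hφ _ _ hlt (slotOf_le θ D y))
    · exact Or.inr ⟨congrArg φ heq, by simpa using hD.1, by simpa using hD.2⟩

end Slots

section Star

open scoped Classical

variable {n h : ℕ} {T : Tournament n} {H : Tournament h} {θ : Equiv.Perm (Fin h)}
  {leaf : Fin h → Bool} {slot : Fin h → ℕ} {K c q d C : ℕ} {s : Finset (Fin n)}
  {S : ℕ → Bool → Finset (Fin n)} {Z : Fin h → Finset (Fin n)}

theorem IsFamily.subset (hZ : IsFamily T θ leaf slot S d Z) (hS : T.IsBlueprint s K c q S)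
    (hlay : IsLayout θ leaf slot K) (x : Fin h) : Z x ⊆ s :=
  (hZ.1 x).1.trans (hS.subset _ (hlay.1 x) _)

theorem IsFamily.card_le (hZ : IsFamily T θ leaf slot S d Z) (hS : T.IsBlueprint s K c q S)
    (hlay : IsLayout θ leaf slot K) {x : Fin h} (hx : leaf x = false) :
    s.card ≤ c * d * #(Z x) := by
  have := (hZ.1 x).2
  rw [hx] at this
  rw [mul_assoc]
  exact (hS.card_le _ (hlay.1 x)).trans (Nat.mul_le_mul_left _ this)

theorem IsFamily.trSize_le (hZ : IsFamily T θ leaf slot S d Z) (hS : T.IsBlueprint s K c q S)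
    (hlay : IsLayout θ leaf slot K) {x : Fin h} (hx : leaf x = true) :
    T.trSizeOn s ≤ c * d * #(Z x) := by
  have := (hZ.1 x).2
  rw [hx] at this
  rw [mul_assoc]
  exact (hS.trSize_le _ (hlay.1 x)).trans (Nat.mul_le_mul_left _ this)

theorem IsFamily.trans (hZ : IsFamily T θ leaf slot S d Z) (hS : T.IsBlueprint s K c q S)
    (hlay : IsLayout θ leaf slot K) {x : Fin h} (hx : leaf x = true) : T.IsTransOn (Z x) := by
  have := (hZ.1 x).1
  rw [hx] at this
  exact (hS.trans _ (hlay.1 x)).subset this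

theorem IsFamily.disjoint (hZ : IsFamily T θ leaf slot S d Z) (hS : T.IsBlueprint s K c q S)
    (hlay : IsLayout θ leaf slot K) {x y : Fin h} (hx : leaf x = false) (hne : x ≠ y) :
    Disjoint (Z x) (Z y) := by
  rcases lt_or_gt_of_ne (fun e => hne (pos_injective θ e) : pos θ x ≠ pos θ y) with hlt | hlt
  · rcases hlay.2 x y hlt with hs | ⟨-, hx', -⟩
    · exact (hS.dense _ _ hs (hlay.1 y) _ _).1.mono (hZ.1 x).1 (hZ.1 y).1
    · simp [hx] at hx'
  · rcases hlay.2 y x hlt with hs | ⟨-, -, hx'⟩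
    · exact ((hS.dense _ _ hs (hlay.1 x) _ _).1.mono (hZ.1 y).1 (hZ.1 x).1).symm
    · simp [hx] at hx'

theorem exists_subset_forall {κ α : Type*} (I : Finset κ) (P : κ → α → Prop)
    (X : Finset α) {N c h C : ℕ} (hI : #I ≤ h) (hc : 0 < c) (hX : N ≤ c * #X)
    (hC : 2 * (h + 1) * c ≤ C) (hP : ∀ x ∈ I, ∀ Y ⊆ X, N ≤ C * #Y → ∃ v ∈ Y, P x v) :
    ∃ X' ⊆ X, #X ≤ 2 * #X' ∧ ∀ v ∈ X', ∀ x ∈ I, P x v := by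
  have hB : ∀ x ∈ I, C * #{v ∈ X | ¬ P x v} ≤ c * #X := by
    intro x hx
    by_contra! hlt
    obtain ⟨v, hv, hPv⟩ := hP x hx _ (filter_subset _ _) (hX.trans hlt.le)
    exact (mem_filter.1 hv).2 hPv
  have h1 : C * #(I.biUnion fun x => {v ∈ X | ¬ P x v}) ≤ h * (c * #X) :=
    calc _ ≤ C * ∑ x ∈ I, #{v ∈ X | ¬ P x v} := Nat.mul_le_mul_left _ card_biUnion_le
      _ = ∑ x ∈ I, C * #{v ∈ X | ¬ P x v} := mul_sum _ _ _
      _ ≤ #I * (c * #X) := (sum_le_card_nsmul _ _ _ hB).trans_eq (smul_eq_mul _ _)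
      _ ≤ _ := Nat.mul_le_mul_right _ hI
  have h2 : 2 * #(I.biUnion fun x => {v ∈ X | ¬ P x v}) ≤ #X := by
    refine Nat.le_of_mul_le_mul_left ?_ (show 0 < (h + 1) * c by positivity)
    calc _ = 2 * (h + 1) * c * #(I.biUnion fun x => {v ∈ X | ¬ P x v}) := by ring
      _ ≤ C * #(I.biUnion fun x => {v ∈ X | ¬ P x v}) := Nat.mul_le_mul_right _ hC
      _ ≤ h * (c * #X) := h1
      _ ≤ (h + 1) * (c * #X) := Nat.mul_le_mul_right _ (by omega)
      _ = _ := by ring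
  have h3 := le_card_sdiff (I.biUnion fun x => {v ∈ X | ¬ P x v}) X
  refine ⟨X \ (I.biUnion fun x => {v ∈ X | ¬ P x v}), sdiff_subset, by omega, fun v hv x hx => ?_⟩
  rw [mem_sdiff, mem_biUnion] at hv
  by_contra hn
  exact hv.2 ⟨x, hx, mem_filter.2 ⟨hv.1, hn⟩⟩

theorem IsFamily.exists_in (hZ : IsFamily T θ leaf slot S d Z) (hS : T.IsBlueprint s K c q S)
    (hlay : IsLayout θ leaf slot K) (hR : T.Rich C s) (hcd : 0 < c * d)
    (hC : 2 * (h + 1) * (c * d) ≤ C) {z : Fin h} (hz : leaf z = false) {L : Finset (Fin h)}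
    (hL : ∀ x ∈ L, leaf x = true) :
    ∃ X ⊆ Z z, #(Z z) ≤ 2 * #X ∧ ∀ v ∈ X, ∀ x ∈ L, ∃ u ∈ Z x, T.adj u v := by
  refine exists_subset_forall L (fun x v => ∃ u ∈ Z x, T.adj u v) (Z z)
    (by simpa using card_le_univ L) hcd (hZ.card_le hS hlay hz) hC fun x hx Y hY hYc => ?_
  obtain ⟨v, hv, u, hu, hvu⟩ := hR.not_complete_right (hY.trans (hZ.subset hS hlay z))
    (hZ.subset hS hlay x) hYc (hZ.trans hS hlay (hL x hx))
    ((hZ.trSize_le hS hlay (hL x hx)).trans (Nat.mul_le_mul_right _ (by nlinarith)))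
  have hzx : z ≠ x := by
    rintro rfl
    simp [hL _ hx] at hz
  have hne : v ≠ u := fun e =>
    disjoint_left.1 (hZ.disjoint hS hlay hz hzx) (hY hv) (e ▸ hu)
  exact ⟨v, hv, u, hu, adj_of_not_adj hne hvu⟩

theorem IsFamily.exists_out (hZ : IsFamily T θ leaf slot S d Z) (hS : T.IsBlueprint s K c q S)
    (hlay : IsLayout θ leaf slot K) (hR : T.Rich C s) (hcd : 0 < c * d)
    (hC : 2 * (h + 1) * (c * d) ≤ C) {z : Fin h} (hz : leaf z = false) {L : Finset (Fin h)}
    (hL : ∀ x ∈ L, leaf x = true) :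
    ∃ X ⊆ Z z, #(Z z) ≤ 2 * #X ∧ ∀ v ∈ X, ∀ x ∈ L, ∃ u ∈ Z x, T.adj v u := by
  refine exists_subset_forall L (fun x v => ∃ u ∈ Z x, T.adj v u) (Z z)
    (by simpa using card_le_univ L) hcd (hZ.card_le hS hlay hz) hC fun x hx Y hY hYc => ?_
  obtain ⟨v, hv, u, hu, hvu⟩ := hR.not_complete_left (hY.trans (hZ.subset hS hlay z))
    (hZ.subset hS hlay x) hYc (hZ.trans hS hlay (hL x hx))
    ((hZ.trSize_le hS hlay (hL x hx)).trans (Nat.mul_le_mul_right _ (by nlinarith)))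
  have hzx : z ≠ x := by
    rintro rfl
    simp [hL _ hx] at hz
  have hne : u ≠ v := fun e =>
    disjoint_left.1 (hZ.disjoint hS hlay hz hzx) (hY hv) (e ▸ hu)
  exact ⟨v, hv, u, hu, adj_of_not_adj hne hvu⟩

theorem IsFamily.exists_frontierStar (hZ : IsFamily T θ leaf slot S d Z)
    (hS : T.IsBlueprint s K c q S) (hlay : IsLayout θ leaf slot K) (hR : T.Rich C s)
    (hcd : 0 < c * d) (hC : 2 * (h + 1) * (c * d) ≤ C) (hs : 0 < #s)
    {Q : Finset (Fin h)} {z : Fin h} (hQ : H.IsFrontierStarAt θ Q z) (hz : leaf z = false)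
    (hL : ∀ x ∈ Q.erase z, leaf x = true)
    (hslot : ∀ x ∈ Q.erase z, ∀ y ∈ Q.erase z, slot x = slot y) :
    ∃ f : Fin h → Fin n, (∀ x ∈ Q, f x ∈ Z x) ∧
      ∀ x ∈ Q, ∀ y ∈ Q, H.adj x y → T.adj (f x) (f y) := by
  have hfwd : (∀ u ∈ Q, ∀ v ∈ Q, H.Backward θ u v → u = z ∨ v = z) := by
    rcases hQ with hQ | hQ
    · exact fun u hu v hv hb => Or.inr (hQ.2.2.2 u hu v hv hb)
    · exact fun u hu v hv hb => Or.inl (hQ.2.2.2 u hu v hv hb)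
  have hnb : ∀ X : Finset (Fin n), #(Z z) ≤ 2 * #X → X.Nonempty := fun X hX =>
    card_pos.1 (by
      have := Nat.pos_of_mul_pos_left (hs.trans_le (hZ.card_le hS hlay hz))
      omega)
  suffices hmain : ∃ v ∈ Z z, ∃ g : Fin h → Fin n, ∀ x ∈ Q.erase z, g x ∈ Z x ∧
      (H.adj x z → T.adj (g x) v) ∧ (H.adj z x → T.adj v (g x)) by
    obtain ⟨v, hv, g, hg⟩ := hmain
    refine ⟨Function.update g z v, fun x hx => ?_, fun x hx y hy hxy => ?_⟩
    · by_cases hxz : x = z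
      · subst hxz; simpa using hv
      · rw [Function.update_of_ne hxz]
        exact (hg x (mem_erase.2 ⟨hxz, hx⟩)).1
    · by_cases hxz : x = z <;> by_cases hyz : y = z
      · subst hxz hyz
        exact absurd hxy (H.adj_irrefl _)
      · subst hxz
        simpa [hyz] using (hg y (mem_erase.2 ⟨hyz, hy⟩)).2.2 hxy
      · subst hyz
        simpa [hxz] using (hg x (mem_erase.2 ⟨hxz, hx⟩)).2.1 hxy
      · rw [Function.update_of_ne hxz, Function.update_of_ne hyz]
        have hx' := mem_erase.2 ⟨hxz, hx⟩
        have hy' := mem_erase.2 ⟨hyz, hy⟩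
        have hlt : pos θ x < pos θ y := by
          by_contra hn
          have hne : pos θ y ≠ pos θ x := fun e => H.adj_irrefl x (by
            rwa [pos_injective θ e] at hxy)
          exact (hfwd x hx y hy ⟨hxy, lt_of_le_of_ne (not_lt.1 hn) hne⟩).elim hxz hyz
        exact hZ.2 x y hlt (hslot x hx' y hy') _ (hg x hx').1 _ (hg y hy').1
  rcases hQ with hQ | hQ
  · obtain ⟨X, hX, hXc, hXv⟩ := hZ.exists_in hS hlay hR hcd hC hz hL
    obtain ⟨v, hv⟩ := hnb _ hXc
    refine ⟨v, hX hv, ?_⟩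
    have : ∀ x, ∃ u, x ∈ Q.erase z → u ∈ Z x ∧ T.adj u v := by
      intro x
      by_cases hx : x ∈ Q.erase z
      · obtain ⟨u, hu⟩ := hXv v hv x hx
        exact ⟨u, fun _ => hu⟩
      · exact ⟨v, fun h => absurd h hx⟩
    choose g hg using this
    exact ⟨g, fun x hx => ⟨(hg x hx).1, fun _ => (hg x hx).2,
      fun hzx => absurd hzx (H.asymm _ _ (hQ.2.2.1 x hx).2)⟩⟩
  · obtain ⟨X, hX, hXc, hXv⟩ := hZ.exists_out hS hlay hR hcd hC hz hL
    obtain ⟨v, hv⟩ := hnb _ hXc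
    refine ⟨v, hX hv, ?_⟩
    have : ∀ x, ∃ u, x ∈ Q.erase z → u ∈ Z x ∧ T.adj v u := by
      intro x
      by_cases hx : x ∈ Q.erase z
      · obtain ⟨u, hu⟩ := hXv v hv x hx
        exact ⟨u, fun _ => hu⟩
      · exact ⟨v, fun h => absurd h hx⟩
    choose g hg using this
    exact ⟨g, fun x hx => ⟨(hg x hx).1,
      fun hxz => absurd hxz (H.asymm _ _ (hQ.2.2.1 x hx).2), fun _ => (hg x hx).2⟩⟩

end Star

section SuperNebula

open scoped Classical

variable {n h : ℕ} {T : Tournament n} {H : Tournament h} {θ : Equiv.Perm (Fin h)}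
  {leaf : Fin h → Bool} {slot : Fin h → ℕ} {K c q d C : ℕ} {s : Finset (Fin n)}
  {S : ℕ → Bool → Finset (Fin n)} {Z : Fin h → Finset (Fin n)}

theorem IsFamily.exists_middleSuper2Nebula (hZ : IsFamily T θ leaf slot S d Z)
    (hS : T.IsBlueprint s K c q S) (hlay : IsLayout θ leaf slot K) (hR : T.Rich C s)
    (hcd : 0 < c * d) (hC : 2 * (h + 1) * (c * d) ≤ C)
    {V L₁ L₂ : Finset (Fin h)} {c₁ c₂ : Fin h}
    (hV : H.IsSuper2NebulaAt θ V c₁ c₂ L₁ L₂ NebKind.middle)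
    (hc₁ : leaf c₁ = false) (hc₂ : leaf c₂ = false) (hL : ∀ x ∈ L₁ ∪ L₂, leaf x = true)
    (hslot : ∀ x ∈ L₁ ∪ L₂, ∀ y ∈ L₁ ∪ L₂, slot x = slot y)
    (htri : ∀ a ∈ Z c₁, ∀ x ∈ L₁ ∪ L₂, ∀ b ∈ Z x, ∀ e ∈ Z c₂,
      T.adj b a → T.adj e b → ¬ T.adj e a) :
    ∃ f : Fin h → Fin n, (∀ x ∈ V, f x ∈ Z x) ∧
      ∀ x ∈ V, ∀ y ∈ V, H.adj x y → T.adj (f x) (f y) := by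
  obtain ⟨⟨-, -, hdisj, hn₁, hn₂, hne, hVeq, -⟩, hpos, hadj₁, hadj₂, hadj, hback⟩ := hV
  obtain ⟨X, hX, hXc, hXv⟩ := hZ.exists_in hS hlay hR hcd hC hc₁ (L := L₁)
    fun x hx => hL x (mem_union_left _ hx)
  obtain ⟨Y, hY, hYc, hYv⟩ := hZ.exists_out hS hlay hR hcd hC hc₂ (L := L₂)
    fun x hx => hL x (mem_union_right _ hx)
  have hlarge : ∀ {z : Fin h} {W : Finset (Fin n)}, leaf z = false → #(Z z) ≤ 2 * #W →
      #s ≤ C * #W := fun {z W} hz hW =>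
    calc #s ≤ c * d * #(Z z) := hZ.card_le hS hlay hz
      _ ≤ c * d * (2 * #W) := Nat.mul_le_mul_left _ hW
      _ = 2 * (c * d) * #W := by ring
      _ ≤ C * #W := Nat.mul_le_mul_right _ (le_trans (by nlinarith) hC)
  obtain ⟨v, hv, w, hw, hvw⟩ := hR.not_complete (le_trans (by nlinarith) hC)
    (hX.trans (hZ.subset hS hlay c₁)) (hY.trans (hZ.subset hS hlay c₂))
    (hlarge hc₁ hXc) (hlarge hc₂ hYc)
  have hdis : ∀ {z x : Fin h} {a b : Fin n}, leaf z = false → z ≠ x → a ∈ Z z → b ∈ Z x → a ≠ b :=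
    fun hz hzx ha hb e => disjoint_left.1 (hZ.disjoint hS hlay hz hzx) ha (e ▸ hb)
  have hwv : T.adj w v := adj_of_not_adj (hdis hc₁ hne (hX hv) (hY hw)) hvw
  have hex : ∀ x, ∃ u, x ∈ L₁ ∪ L₂ → u ∈ Z x ∧
      (x ∈ L₁ → T.adj u v ∧ T.adj u w) ∧ (x ∈ L₂ → T.adj v u ∧ T.adj w u) := by
    intro x
    by_cases hx₁ : x ∈ L₁
    · obtain ⟨u, hu, huv⟩ := hXv v hv x hx₁
      have hx := mem_union_left L₂ hx₁
      refine ⟨u, fun _ => ⟨hu, fun _ => ⟨huv, ?_⟩,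
        fun hx₂ => absurd hx₂ (disjoint_left.1 hdisj hx₁)⟩⟩
      exact adj_of_not_adj (hdis hc₂ (fun e => hn₂ (e ▸ hx)) (hY hw) hu)
        fun hwu => htri v (hX hv) x hx u hu w (hY hw) huv hwu hwv
    · by_cases hx₂ : x ∈ L₂
      · obtain ⟨u, hu, hwu⟩ := hYv w hw x hx₂
        have hx := mem_union_right L₁ hx₂
        refine ⟨u, fun _ => ⟨hu, fun h => absurd h hx₁, fun _ => ⟨?_, hwu⟩⟩⟩
        exact adj_of_not_adj (hdis hc₁ (fun e => hn₁ (e ▸ hx)) (hX hv) hu).symm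
          fun huv => htri v (hX hv) x hx u hu w (hY hw) huv hwu hwv
      · exact ⟨v, fun hx => absurd hx (by simp [hx₁, hx₂])⟩
  choose g hg using hex
  have hcases : ∀ x ∈ V, x = c₁ ∨ x = c₂ ∨ x ∈ L₁ ∪ L₂ := by
    intro x hx
    simpa [hVeq] using hx
  have hleaf : ∀ x ∈ L₁ ∪ L₂, x ≠ c₁ ∧ x ≠ c₂ := fun x hx =>
    ⟨fun e => hn₁ (e ▸ hx), fun e => hn₂ (e ▸ hx)⟩
  refine ⟨fun x => if x = c₁ then v else if x = c₂ then w else g x, ?_, ?_⟩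
  · intro x hx
    rcases hcases x hx with rfl | rfl | hxL
    · simpa using hX hv
    · simpa [hne.symm] using hY hw
    · simpa [hleaf x hxL] using (hg x hxL).1
  · intro x hx y hy hxy
    have hb := hback x hx y hy
    rcases hcases x hx with rfl | rfl | hxL <;> rcases hcases y hy with rfl | rfl | hyL
    · exact absurd hxy (H.adj_irrefl _)
    · exact absurd hadj (H.asymm _ _ hxy)
    · have hy₂ : y ∈ L₂ := (mem_union.1 hyL).resolve_left fun hy₁ =>
        H.asymm _ _ hxy (hadj₁ y hy₁)
      simpa [hleaf y hyL] using ((hg y hyL).2.2 hy₂).1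
    · simpa [hne.symm] using hwv
    · exact absurd hxy (H.adj_irrefl _)
    · have hy₂ : y ∈ L₂ := by
        rcases hb ⟨hxy, (hpos y hyL).2⟩ with h | h | h
        · exact absurd h.2 (hleaf y hyL).1
        · exact h.2
        · exact absurd h.2 (hleaf y hyL).1
      simpa [hleaf y hyL, hne.symm] using ((hg y hyL).2.2 hy₂).2
    · have hx₁ : x ∈ L₁ := by
        rcases hb ⟨hxy, (hpos x hxL).1⟩ with h | h | h
        · exact h.1
        · exact absurd h.1 (hleaf x hxL).2
        · exact absurd h.1 (hleaf x hxL).2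
      simpa [hleaf x hxL] using ((hg x hxL).2.1 hx₁).1
    · have hx₁ : x ∈ L₁ := (mem_union.1 hxL).resolve_right fun hx₂ =>
        H.asymm _ _ hxy (hadj₂ x hx₂)
      simpa [hleaf x hxL, hne.symm] using ((hg x hxL).2.1 hx₁).2
    · have hlt : pos θ x < pos θ y := by
        by_contra hn
        have hne : pos θ y ≠ pos θ x := fun e => H.adj_irrefl x (by
          rwa [pos_injective θ e] at hxy)
        rcases hb ⟨hxy, lt_of_le_of_ne (not_lt.1 hn) hne⟩ with h | h | h
        · exact (hleaf y hyL).1 h.2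
        · exact (hleaf x hxL).2 h.1
        · exact (hleaf x hxL).2 h.1
      simpa [hleaf x hxL, hleaf y hyL] using
        hZ.2 x y hlt (hslot x hxL y hyL) _ (hg x hxL).1 _ (hg y hyL).1

end SuperNebula

section SigmaGalaxy

open scoped Classical

variable {n h : ℕ} {T : Tournament n} {H : Tournament h} {θ : Equiv.Perm (Fin h)}
  {K c C : ℕ} {s : Finset (Fin n)} {S : ℕ → Bool → Finset (Fin n)}

theorem IsFrontierStarAt.center_mem {Q : Finset (Fin h)} {z : Fin h}
    (hQ : H.IsFrontierStarAt θ Q z) : z ∈ Q :=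
  hQ.elim (fun hQ => hQ.1) fun hQ => hQ.1

theorem IsFrontierStarAt.not_betweenSet {Q : Finset (Fin h)} {z : Fin h}
    (hQ : H.IsFrontierStarAt θ Q z) : ¬ BetweenSet θ (Q.erase z) z := by
  rintro ⟨u, hu, w, hw, huz, hzw⟩
  rcases hQ with hQ | hQ
  · exact huz.not_gt (hQ.2.2.1 u hu).1
  · exact hzw.not_gt (hQ.2.2.1 w hw).1

/-- Translates the three segments after `t₁`, `t₂` and `t₃` so that these three values are sent
to `i`, `j` and `k`. -/
def stretch (t₁ t₂ t₃ i j k t : ℕ) : ℕ :=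
  if t < t₁ then t else if t < t₂ then i + (t - t₁) else if t < t₃ then j + (t - t₂)
    else k + (t - t₃)

theorem IsBlueprint.contains_middleSigmaGalaxy {V L₁ L₂ : Finset (Fin h)} {c₁ c₂ : Fin h} {m : ℕ}
    {Q : Fin m → Finset (Fin h)} {ctr : Fin m → Fin h}
    (hH : H.SigmaGalaxyDecomp θ V c₁ c₂ L₁ L₂ NebKind.middle Q ctr)
    (hS : T.IsBlueprint s K c (2 * (h + 1) * (2 * (h + 1))) S) (hc : 0 < c) (hR : T.Rich C s)
    (hC : 2 * (h + 1) * (c * (2 * (2 * (h + 1)))) ≤ C) (htr : c * (h + 1) ≤ T.trSizeOn s)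
    {M i j k : ℕ} (hM : 2 * h < M) (hi : M ≤ i) (hij : i + M ≤ j) (hjk : j + M ≤ k)
    (hk : k + M ≤ K)
    (htri : ∀ a ∈ S i false, ∀ b ∈ S j true, ∀ e ∈ S k false,
      T.adj b a → T.adj e b → ¬ T.adj e a) : T.Contains H := by
  obtain ⟨hV, hQ, hQQ, hVQ, hcov, hback, hctrL, hcQ, hctrQ⟩ := hH
  obtain ⟨⟨⟨x₀, hx₀⟩, -, -, hn₁, hn₂, hne, hVeq, -⟩, hpos, -⟩ := id hV
  have hLV : L₁ ∪ L₂ ⊆ V := by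
    rw [hVeq]
    exact (subset_insert _ _).trans (subset_insert _ _)
  have hc₁V : c₁ ∈ V := by simp [hVeq]
  have hc₂V : c₂ ∈ V := by simp [hVeq]
  let D : Finset (Fin h) := insert c₁ (insert c₂ (univ.image ctr))
  have hD : ∀ x, x ∈ D ↔ x = c₁ ∨ x = c₂ ∨ ∃ j, ctr j = x := fun x => by simp [D]
  have hLD : ∀ x ∈ L₁ ∪ L₂, x ∉ D := by
    intro x hx hxD
    rcases (hD x).1 hxD with rfl | rfl | ⟨j, rfl⟩
    · exact hn₁ hx
    · exact hn₂ hx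
    · exact disjoint_left.1 (hVQ j) (hLV hx) (hQ j).center_mem
  have hQD : ∀ j, ∀ x ∈ (Q j).erase (ctr j), x ∉ D := by
    intro j x hx hxD
    have hx := mem_erase.1 hx
    rcases (hD x).1 hxD with rfl | rfl | ⟨i, rfl⟩
    · exact disjoint_left.1 (hVQ j) hc₁V hx.2
    · exact disjoint_left.1 (hVQ j) hc₂V hx.2
    · exact disjoint_left.1 (hQQ i j fun e => hx.1 (e ▸ rfl)) (hQ i).center_mem hx.2
  have hDL : ∀ z ∈ D, ¬ BetweenSet θ (L₁ ∪ L₂) z := by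
    intro z hz
    rcases (hD z).1 hz with rfl | rfl | ⟨j, rfl⟩
    · rintro ⟨u, hu, -, -, hlt, -⟩
      exact hlt.not_gt (hpos u hu).1
    · rintro ⟨-, -, w, hw, -, hlt⟩
      exact hlt.not_gt (hpos w hw).2
    · exact hctrL j
  have hDQ : ∀ j, ∀ z ∈ D, ¬ BetweenSet θ ((Q j).erase (ctr j)) z := by
    intro j z hz
    rcases (hD z).1 hz with rfl | rfl | ⟨i, rfl⟩
    · exact (hcQ j).1
    · exact (hcQ j).2
    · by_cases hij : i = j
      · rw [hij]
        exact (hQ j).not_betweenSet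
      · exact hctrQ i j hij
  have hx₀L := mem_union_left L₂ hx₀
  have h₁ : slotOf θ D c₁ < slotOf θ D x₀ :=
    slotOf_lt (hpos x₀ hx₀L).1 (Or.inl (by simp [D]))
  have h₂ : slotOf θ D x₀ < slotOf θ D c₂ :=
    slotOf_lt (hpos x₀ hx₀L).2 (Or.inr (by simp [D]))
  have h₃ := slotOf_le θ D c₂
  set φ := stretch (slotOf θ D c₁) (slotOf θ D x₀) (slotOf θ D c₂) i j k with hφ
  have hφ₁ : φ (slotOf θ D c₁) = i := by
    rw [hφ, stretch]; split_ifs <;> omega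
  have hφ₂ : φ (slotOf θ D c₂) = k := by
    rw [hφ, stretch]; split_ifs <;> omega
  have hφ₀ : ∀ x ∈ L₁ ∪ L₂, φ (slotOf θ D x) = j := by
    intro x hx
    rw [slotOf_eq_of_not_betweenSet hLD hDL hx hx₀L, hφ, stretch]
    split_ifs <;> omega
  have hlay : IsLayout θ (fun x => decide (x ∉ D)) (fun x => φ (slotOf θ D x)) K := by
    refine isLayout_comp_slotOf (fun t ht => ?_) fun t t' htt' ht' => ?_
    · rw [hφ, stretch]; split_ifs <;> omega
    · rw [hφ, stretch, stretch]; split_ifs <;> omega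
  have hs : 0 < #s := (Nat.mul_pos hc h.succ_pos).trans_le (htr.trans (T.trSizeOn_le_card s))
  have hcd : 0 < c * (2 * (2 * (h + 1))) := by positivity
  refine hS.contains hc hlay htr (fun o : Option (Fin m) => o.elim V Q) ?_ ?_ ?_ ?_
  · intro x
    rcases hcov x with hx | ⟨j, hx⟩
    · exact ⟨none, hx⟩
    · exact ⟨some j, hx⟩
  · rintro (_ | i) (_ | j) hij
    · exact absurd rfl hij
    · exact hVQ j
    · exact (hVQ i).symm
    · exact hQQ i j fun e => hij (e ▸ rfl)
  · intro u v huv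
    rcases hback u v huv with hx | ⟨j, hx⟩
    · exact ⟨none, hx⟩
    · exact ⟨some j, hx⟩
  · rintro Z hZ (_ | l)
    · refine hZ.exists_middleSuper2Nebula hS hlay hR hcd hC hV (by simp [D]) (by simp [D])
        (fun x hx => by simpa using hLD x hx) (fun x hx y hy => (hφ₀ x hx).trans (hφ₀ y hy).symm)
        fun a ha x hx b hb e he => htri a ?_ b ?_ e ?_
      · simpa [D, hφ₁] using (hZ.1 c₁).1 ha
      · simpa [hLD x hx, hφ₀ x hx] using (hZ.1 x).1 hb
      · simpa [D, hφ₂] using (hZ.1 c₂).1 he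
    · exact hZ.exists_frontierStar hS hlay hR hcd hC hs (hQ l) (by simp [D])
        (fun x hx => by simpa using hQD l x hx)
        fun x hx y hy => congrArg φ (slotOf_eq_of_not_betweenSet (hQD l) (hDQ l) hx hy)

end SigmaGalaxy

section TriangularGalaxy

open scoped Classical

variable {n h : ℕ} {T : Tournament n} {H : Tournament h} {θ : Equiv.Perm (Fin h)}
  {K c q d C M : ℕ} {s : Finset (Fin n)} {S : ℕ → Bool → Finset (Fin n)}

theorem IsBlueprint.of_le {q' : ℕ} (hS : T.IsBlueprint s K c q S) (hq : q' ≤ q) :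
    T.IsBlueprint s K c q' S :=
  { hS with
    dense := fun i j hij hj b b' => by
      obtain ⟨h1, h2, h3⟩ := hS.dense i j hij hj b b'
      exact ⟨h1, fun u hu => (Nat.mul_le_mul_right _ hq).trans (h2 u hu),
        fun v hv => (Nat.mul_le_mul_right _ hq).trans (h3 v hv)⟩ }

/-- Large subsets of three distant members of a blueprint of a tournament without a given
middle Σ-galaxy span a triangle. -/
theorem IsBlueprint.exists_triangle (hH : H.IsMiddleSigmaGalaxy) (hfree : ¬ T.Contains H)
    (hS : T.IsBlueprint s K c (d * (2 * (h + 1) * (2 * (h + 1)))) S) (hc : 0 < c) (hd : 0 < d)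
    (hR : T.Rich C s) (hC : 2 * (h + 1) * (c * d * (2 * (2 * (h + 1)))) ≤ C)
    (htr : c * d * (h + 1) ≤ T.trSizeOn s) (hM : 2 * h < M) {i j k : ℕ} (hi : M ≤ i)
    (hij : i + M ≤ j) (hjk : j + M ≤ k) (hk : k + M ≤ K) {X Y W : Finset (Fin n)}
    (hX : X ⊆ S i false ∧ #(S i false) ≤ d * #X) (hY : Y ⊆ S j true ∧ #(S j true) ≤ d * #Y)
    (hW : W ⊆ S k false ∧ #(S k false) ≤ d * #W) :
    ∃ a ∈ X, ∃ b ∈ Y, ∃ e ∈ W, T.adj b a ∧ T.adj e b ∧ T.adj e a := by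
  by_contra! hno
  obtain ⟨θ, V, c₁, c₂, L₁, L₂, m, Q, ctr, hdec⟩ := hH
  have hki : k ≠ i := by omega
  let S' : ℕ → Bool → Finset (Fin n) := fun t b =>
    if b = true then if t = j then Y else S t b
    else if t = i then X else if t = k then W else S t b
  have hS' : T.IsBlueprint s K (c * d) (2 * (h + 1) * (2 * (h + 1))) S' := by
    refine hS.refine hd fun t _ b => ?_
    have htriv : S t b ⊆ S t b ∧ #(S t b) ≤ d * #(S t b) :=
      ⟨subset_rfl, Nat.le_mul_of_pos_left _ hd⟩
    cases b
    · by_cases hti : t = i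
      · simpa [S', hti] using hX
      · by_cases htk : t = k
        · simpa [S', htk, hki] using hW
        · simpa [S', hti, htk] using htriv
    · by_cases htj : t = j
      · simpa [S', htj] using hY
      · simpa [S', htj] using htriv
  refine hfree (hS'.contains_middleSigmaGalaxy hdec (Nat.mul_pos hc hd) hR hC htr hM hi hij hjk hk
    fun a ha b hb e he => hno a ?_ b ?_ e ?_)
  · simpa [S'] using ha
  · simpa [S'] using hb
  · simpa [S', hki] using he

theorem IsBlueprint.contains_centralTriangularGalaxy (hH : H.IsCentralTriangularGalaxy)
    (hS : T.IsBlueprint s (M * (2 * h + 2)) c (2 * (h + 1) * (2 * (h + 1))) S) (hc : 0 < c)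
    (hM : 0 < M) (hR : T.Rich C s)
    (hC : 2 * (h + 1) * (c * (2 * (2 * (h + 1)))) ≤ C) (htr : c * (h + 1) ≤ T.trSizeOn s)
    (htri : ∀ i j k, M ≤ i → i + M ≤ j → j + M ≤ k → k + M ≤ M * (2 * h + 2) →
      ∀ X Y W, (X ⊆ S i false ∧ #(S i false) ≤ 2 * (2 * (h + 1)) * #X) →
        (Y ⊆ S j true ∧ #(S j true) ≤ 2 * (2 * (h + 1)) * #Y) →
        (W ⊆ S k false ∧ #(S k false) ≤ 2 * (2 * (h + 1)) * #W) →
        ∃ a ∈ X, ∃ b ∈ Y, ∃ e ∈ W, T.adj b a ∧ T.adj e b ∧ T.adj e a) :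
    T.Contains H := by
  obtain ⟨θ, l, m, A, B, E, Q, ctr, htr', hQ, hΔΔ, hΔQ, hQQ, hback, hctrQ, hforb⟩ := hH
  let D : Finset (Fin h) := univ.image A ∪ univ.image E ∪ univ.image ctr
  have hD : ∀ x, x ∈ D ↔ (∃ i, A i = x) ∨ (∃ i, E i = x) ∨ ∃ j, ctr j = x := fun x => by
    simp [D]
  have hAB : ∀ i, A i ≠ B i := fun i e => (htr' i).1.ne (congrArg _ e)
  have hBE : ∀ i, B i ≠ E i := fun i e => (htr' i).2.1.ne (congrArg _ e)
  have hAE : ∀ i, A i ≠ E i := fun i e =>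
    ((htr' i).1.trans (htr' i).2.1).ne (congrArg _ e)
  have hBD : ∀ i, B i ∉ D := by
    intro i hi
    rcases (hD _).1 hi with ⟨i', e⟩ | ⟨i', e⟩ | ⟨j, e⟩
    · by_cases hii : i' = i
      · exact hAB i (hii ▸ e)
      · exact disjoint_left.1 (hΔΔ i' i hii) (show A i' ∈ _ by simp) (by simp [e])
    · by_cases hii : i' = i
      · exact hBE i (hii ▸ e).symm
      · exact disjoint_left.1 (hΔΔ i' i hii) (show E i' ∈ _ by simp) (by simp [e])
    · exact disjoint_left.1 (hΔQ i j) (show B i ∈ _ by simp) (e ▸ (hQ j).center_mem)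
  have hQD : ∀ j, ∀ x ∈ (Q j).erase (ctr j), x ∉ D := by
    intro j x hx hxD
    have hx := mem_erase.1 hx
    rcases (hD x).1 hxD with ⟨i, rfl⟩ | ⟨i, rfl⟩ | ⟨i, rfl⟩
    · exact disjoint_left.1 (hΔQ i j) (show A i ∈ _ by simp) hx.2
    · exact disjoint_left.1 (hΔQ i j) (show E i ∈ _ by simp) hx.2
    · exact disjoint_left.1 (hQQ i j fun e => hx.1 (e ▸ rfl)) (hQ i).center_mem hx.2
  have hDQ : ∀ j, ∀ z ∈ D, ¬ BetweenSet θ ((Q j).erase (ctr j)) z := by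
    intro j z hz
    rcases (hD z).1 hz with ⟨i, rfl⟩ | ⟨i, rfl⟩ | ⟨i, rfl⟩
    · exact hforb i j _ (by simp)
    · exact hforb i j _ (by simp)
    · by_cases hij : i = j
      · rw [hij]
        exact (hQ j).not_betweenSet
      · exact hctrQ i j hij
  have hlay : IsLayout θ (fun x => decide (x ∉ D)) (fun x => M * (slotOf θ D x + 1))
      (M * (2 * h + 2)) := by
    refine isLayout_comp_slotOf (φ := fun t => M * (t + 1)) (fun t ht => ?_) fun t t' htt' _ => ?_
    · exact Nat.mul_lt_mul_of_pos_left (by omega) hM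
    · exact Nat.mul_lt_mul_of_pos_left (by omega) hM
  have hs : 0 < #s := (Nat.mul_pos hc h.succ_pos).trans_le (htr.trans (T.trSizeOn_le_card s))
  let P : Fin l ⊕ Fin m ⊕ Fin h → Finset (Fin h) :=
    Sum.elim (fun i => {A i, B i, E i}) (Sum.elim Q fun v =>
      {v} \ (univ.biUnion (fun i => {A i, B i, E i}) ∪ univ.biUnion Q))
  have hsingle : ∀ v x, x ∈ P (Sum.inr (Sum.inr v)) ↔
      x = v ∧ (∀ i, x ∉ P (Sum.inl i)) ∧ ∀ j, x ∉ P (Sum.inr (Sum.inl j)) := by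
    intro v x
    simp only [P, Sum.elim_inl, Sum.elim_inr, mem_sdiff, mem_singleton, mem_union, mem_biUnion,
      mem_univ, true_and, not_or, not_exists]
  refine hS.contains hc hlay htr P ?_ ?_ ?_ ?_
  · intro x
    by_contra! hn
    exact hn (Sum.inr (Sum.inr x)) ((hsingle x x).2 ⟨rfl, fun i => hn _, fun j => hn _⟩)
  · rintro (i | i | v) (j | j | w) hij
    · exact hΔΔ i j fun e => hij (e ▸ rfl)
    · exact hΔQ i j
    · exact disjoint_right.2 fun x hx => ((hsingle w x).1 hx).2.1 i
    · exact (hΔQ j i).symm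
    · exact hQQ i j fun e => hij (e ▸ rfl)
    · exact disjoint_right.2 fun x hx => ((hsingle w x).1 hx).2.2 i
    · exact disjoint_left.2 fun x hx => ((hsingle v x).1 hx).2.1 j
    · exact disjoint_left.2 fun x hx => ((hsingle v x).1 hx).2.2 j
    · refine disjoint_left.2 fun x hx hx' => hij ?_
      rw [← ((hsingle v x).1 hx).1, ← ((hsingle w x).1 hx').1]
  · intro u v huv
    rcases hback u v huv with ⟨i, hx⟩ | ⟨j, hx⟩
    · exact ⟨Sum.inl i, hx⟩
    · exact ⟨Sum.inr (Sum.inl j), hx⟩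
  · rintro Z hZ (i | j | v)
    · have h₁ := slotOf_lt (htr' i).1 (Or.inl ((hD _).2 (Or.inl ⟨i, rfl⟩)))
      have h₂ := slotOf_lt (htr' i).2.1 (Or.inr ((hD _).2 (Or.inr (Or.inl ⟨i, rfl⟩))))
      have h₃ := slotOf_le θ D (E i)
      obtain ⟨a, ha, b, hb, e, he, hba, heb, hea⟩ := htri (M * (slotOf θ D (A i) + 1))
        (M * (slotOf θ D (B i) + 1)) (M * (slotOf θ D (E i) + 1)) (by nlinarith) (by nlinarith)
        (by nlinarith) (by nlinarith) (Z (A i)) (Z (B i)) (Z (E i))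
        (by simpa [show A i ∈ D from (hD _).2 (Or.inl ⟨i, rfl⟩)] using hZ.1 (A i))
        (by simpa [hBD i] using hZ.1 (B i))
        (by simpa [show E i ∈ D from (hD _).2 (Or.inr (Or.inl ⟨i, rfl⟩))] using hZ.1 (E i))
      have hadj := (htr' i).2.2
      refine ⟨fun x => if x = A i then a else if x = B i then b else e, ?_, ?_⟩
      · intro x hx
        simp only [P, Sum.elim_inl, mem_insert, mem_singleton] at hx
        rcases hx with rfl | rfl | rfl
        · simpa using ha
        · simpa [(hAB i).symm] using hb
        · simpa [(hAE i).symm, (hBE i).symm] using he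
      · intro x hx y hy hxy
        simp only [P, Sum.elim_inl, mem_insert, mem_singleton] at hx hy
        rcases hx with rfl | rfl | rfl <;> rcases hy with rfl | rfl | rfl
        · exact absurd hxy (H.adj_irrefl _)
        · exact absurd hadj.1 (H.asymm _ _ hxy)
        · exact absurd hadj.2.1 (H.asymm _ _ hxy)
        · simpa [(hAB i).symm] using hba
        · exact absurd hxy (H.adj_irrefl _)
        · exact absurd hadj.2.2 (H.asymm _ _ hxy)
        · simpa [(hAE i).symm, (hBE i).symm] using hea
        · simpa [(hAE i).symm, (hBE i).symm, (hAB i).symm] using heb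
        · exact absurd hxy (H.adj_irrefl _)
    · exact hZ.exists_frontierStar hS hlay hR (by positivity) hC hs (hQ j)
        (by simpa using (hD _).2 (Or.inr (Or.inr ⟨j, rfl⟩)))
        (fun x hx => by simpa using hQD j x hx)
        fun x hx y hy => congrArg (fun t => M * (t + 1))
          (slotOf_eq_of_not_betweenSet (hQD j) (hDQ j) hx hy)
    · refine ⟨fun _ => (hS.family_nonempty hc hlay htr hZ v).choose, fun x hx => ?_,
        fun x hx y hy hxy => ?_⟩
      · rw [((hsingle v x).1 hx).1]
        exact (hS.family_nonempty hc hlay htr hZ v).choose_spec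
      · rw [((hsingle v x).1 hx).1, ((hsingle v y).1 hy).1] at hxy
        exact absurd hxy (H.adj_irrefl v)

/-- Large vertex sets are not rich if neither pattern occurs. -/
theorem exists_not_rich {h₁ h₂ : ℕ} {H₁ : Tournament h₁} {H₂ : Tournament h₂}
    (hH₁ : H₁.IsMiddleSigmaGalaxy) (hH₂ : H₂.IsCentralTriangularGalaxy) :
    ∃ C N : ℕ, 2 ≤ C ∧ ∀ {n : ℕ} (T : Tournament n), ¬ T.Contains H₁ → ¬ T.Contains H₂ →
      ∀ s : Finset (Fin n), N ≤ #s → ¬ T.Rich C s := by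
  set d := 2 * (2 * (h₂ + 1)) with hd
  obtain ⟨c, hc, hbp⟩ := exists_isBlueprint H₁ ((2 * h₁ + 1) * (2 * h₂ + 2))
    (max (2 * (h₂ + 1) * (2 * (h₂ + 1))) (d * (2 * (h₁ + 1) * (2 * (h₁ + 1)))))
    (by positivity) (by positivity)
  refine ⟨2 + c + 2 * (h₂ + 1) * (c * d) + 2 * (h₁ + 1) * (c * d * (2 * (2 * (h₁ + 1)))),
    c + 2 ^ (c * (h₂ + 1) + c * d * (h₁ + 1)), by omega, fun T hT₁ hT₂ s hs hR => ?_⟩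
  obtain ⟨S, hS⟩ := hbp T hT₁ s (le_of_add_le_left hs) _ (by omega) hR
  have htr := T.le_trSizeOn_of_two_pow_le _ s (le_of_add_le_right hs)
  exact hT₂ ((hS.of_le (le_max_left _ _)).contains_centralTriangularGalaxy hH₂ hc (by omega) hR
    (by rw [← hd]; omega) (by omega) fun i j k hi hij hjk hk X Y W hX hY hW =>
      (hS.of_le (le_max_right _ _)).exists_triangle hH₁ hT₁ hc (by omega) hR (by omega) (by omega)
        (by omega) hi hij hjk hk hX hY hW)

end TriangularGalaxy

theorem exists_exponent {C : ℕ} (hC : 2 ≤ C) (N : ℕ) :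
    ∃ ε : ℝ, 0 < ε ∧ (C : ℝ) ^ ε * (C - 1) < C ∧ ((N + 1 : ℕ) : ℝ) ^ ε < 2 := by
  have hC' : (2 : ℝ) ≤ C := by exact_mod_cast hC
  have h1 : ∀ᶠ ε in nhdsWithin (0 : ℝ) (Set.Ioi 0), (C : ℝ) ^ ε * (C - 1) < C := by
    refine Filter.Eventually.filter_mono nhdsWithin_le_nhds (ContinuousAt.eventually_lt
      (((Real.continuous_const_rpow (by positivity)).mul continuous_const).continuousAt)
      continuousAt_const ?_)
    simp
  have h2 : ∀ᶠ ε in nhdsWithin (0 : ℝ) (Set.Ioi 0), ((N + 1 : ℕ) : ℝ) ^ ε < 2 := by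
    refine Filter.Eventually.filter_mono nhdsWithin_le_nhds (ContinuousAt.eventually_lt
      (Real.continuous_const_rpow (by positivity)).continuousAt continuousAt_const ?_)
    simp
  obtain ⟨ε, h1, h2, hε⟩ := (h1.and (h2.and self_mem_nhdsWithin)).exists
  exact ⟨ε, hε, h1, h2⟩

theorem card_rpow_le_trSizeOn {n C N : ℕ} {ε : ℝ} (T : Tournament n) (hε : 0 < ε)
    (hCε : (C : ℝ) ^ ε * (C - 1) < C) (hC : 2 ≤ C) (hNε : ((N + 1 : ℕ) : ℝ) ^ ε < 2)
    (hR : ∀ s : Finset (Fin n), N ≤ #s → ¬ T.Rich C s) (s : Finset (Fin n)) :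
    (#s : ℝ) ^ ε ≤ T.trSizeOn s := by
  induction s using Finset.strongInduction with
  | H s ih =>
    by_contra! hlt
    have hs : 1 ≤ #s := by
      by_contra! h0
      have h0 : #s = 0 := by omega
      rw [h0, Nat.cast_zero, Real.zero_rpow hε.ne'] at hlt
      exact hlt.not_ge (Nat.cast_nonneg _)
    have htr : 1 ≤ T.trSizeOn s := T.le_trSizeOn_of_two_pow_le 0 s (by simpa using hs)
    have hs2 : 2 ≤ #s := by
      by_contra! h1
      have h1 : #s = 1 := by omega
      rw [h1, Nat.cast_one, Real.one_rpow] at hlt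
      exact hlt.not_ge (by exact_mod_cast htr)
    have htr2 : (2 : ℝ) ≤ T.trSizeOn s := by
      exact_mod_cast T.le_trSizeOn_of_two_pow_le 1 s (by simpa using hs2)
    have hN : N + 1 ≤ #s := by
      by_contra! hsN
      have := Real.rpow_le_rpow (Nat.cast_nonneg #s)
        (show (#s : ℝ) ≤ (N + 1 : ℕ) by exact_mod_cast hsN.le) hε.le
      linarith
    refine hR s (by omega) fun X hX hXc => ?_
    rcases hX.eq_or_ssubset with rfl | hss
    · omega
    · have h1 : (#s : ℝ) ^ ε ≤ (C : ℝ) ^ ε * (#X : ℝ) ^ ε := by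
        rw [← Real.mul_rpow (Nat.cast_nonneg _) (Nat.cast_nonneg _)]
        exact Real.rpow_le_rpow (Nat.cast_nonneg _) (by exact_mod_cast hXc) hε.le
      have h2 := ih X hss
      have hC' : (2 : ℝ) ≤ C := by exact_mod_cast hC
      have h3 : ((C : ℝ) - 1) * T.trSizeOn s < C * T.trSizeOn X :=
        calc ((C : ℝ) - 1) * T.trSizeOn s
            < (C - 1) * ((C : ℝ) ^ ε * T.trSizeOn X) :=
              mul_lt_mul_of_pos_left (hlt.trans_le (h1.trans
                (mul_le_mul_of_nonneg_left h2 (by positivity)))) (by linarith)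
          _ = (C : ℝ) ^ ε * (C - 1) * T.trSizeOn X := by ring
          _ ≤ C * T.trSizeOn X := mul_le_mul_of_nonneg_right hCε.le (Nat.cast_nonneg _)
      have h4 : (C : ℝ) * T.trSizeOn s < C * T.trSizeOn X + T.trSizeOn s := by linarith
      exact_mod_cast h4

end Tournament

theorem stmt8 {n₁ n₂ : ℕ} (H₁ : Tournament n₁) (H₂ : Tournament n₂)
    (h₁ : H₁.IsMiddleSigmaGalaxy) (h₂ : H₂.IsCentralTriangularGalaxy) : EHPair H₁ H₂ := by
  obtain ⟨C, N, hC, hR⟩ := exists_not_rich h₁ h₂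
  obtain ⟨ε, hε, hCε, hNε⟩ := exists_exponent hC N
  refine ⟨ε, hε, fun n T hT₁ hT₂ => ?_⟩
  simpa [trSize] using card_rpow_le_trSizeOn T hε hCε hC hNε (hR T hT₁ hT₂) univ
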